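/- Let k be a field, A a finite-dimensional symmetric k-algebra (i.e., A ≅ D(A) as A-A-bimodules, equivalently A carries a nondegenerate, symmetric, associative k-bilinear form), M a finitely generated generator for A-mod, and B = End_A(M). If B is virtually Gorenstein and B has infinite dominant dimension (there is an exact sequence 0 → B → I^0 → I^1 → ⋯ of left B-modules in which every I^n is both projective and injective), then B is a symmetric algebra. (Corollary 1.4, second part: any gendo-symmetric, virtually Gorenstein algebra with infinite dominant dimension is symmetric.) -/

import Mathlib

open CategoryTheory
/-! ## Additive closure classes -/

section AddClosure

variable (A : Type) [Ring A]

/-- `X ∈ add M`: `X` is a direct summand of a finite direct sum of copies of `M`. -/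
def MemAdd (M X : ModuleCat.{0} A) : Prop :=
  ∃ (n : ℕ) (Y : ModuleCat.{0} A), Nonempty ((↥X × ↥Y) ≃ₗ[A] (Fin n → ↥M))

/-- `X ∈ Add M`: `X` is a direct summand of an arbitrary direct sum of copies of `M`. -/
def MemAddBig (M X : ModuleCat.{0} A) : Prop :=
  ∃ (I : Type) (Y : ModuleCat.{0} A), Nonempty ((↥X × ↥Y) ≃ₗ[A] (I →₀ ↥M))

/-- a morphism of `A`-modules factors through a projective module -/
def FactorsThroughProj {X Y : ModuleCat.{0} A} (f : X ⟶ Y) : Prop :=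
  ∃ (P : ModuleCat.{0} A) (_ : Module.Projective A P) (g : X ⟶ P) (h : P ⟶ Y), f = g ≫ h

/-- a morphism of `A`-modules factors through a module in `Add M` -/
def FactorsThroughAddM (M : ModuleCat.{0} A) {X Y : ModuleCat.{0} A} (f : X ⟶ Y) : Prop :=
  ∃ (Z : ModuleCat.{0} A) (_ : MemAddBig A M Z) (g : X ⟶ Z) (h : Z ⟶ Y), f = g ≫ h

/-- `X ∈ add M` for unbundled modules. -/
def MemAddPlain (M : Type) [AddCommGroup M] [Module A M]
    (X : Type) [AddCommGroup X] [Module A X] : Prop :=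
  ∃ (n : ℕ) (Y : ModuleCat.{0} A), Nonempty ((X × ↥Y) ≃ₗ[A] (Fin n → M))

end AddClosure

/-! ## Gorenstein homological algebra -/

section Gorenstein

variable (B : Type) [Ring B]

/-- `G` is a Gorenstein-projective `B`-module: `G` is the kernel at degree `0` of an
exact complex `P•` of projective modules such that `Hom_B(P•, B)` is exact. -/
def IsGProj (G : ModuleCat.{0} B) : Prop :=
  ∃ (P : ℤ → ModuleCat.{0} B) (d : ∀ i : ℤ, P i ⟶ P (i + 1)),
    (∀ i, Module.Projective B (P i)) ∧
    (∀ i, LinearMap.range (d i).hom = LinearMap.ker (d (i + 1)).hom) ∧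
    (∀ (i : ℤ) (φ : P (i + 1) ⟶ ModuleCat.of B B),
      d i ≫ φ = 0 ↔ ∃ ψ : P (i + 1 + 1) ⟶ ModuleCat.of B B, φ = d (i + 1) ≫ ψ) ∧
    Nonempty (↥G ≃ₗ[B] ↥(LinearMap.ker (d 0).hom))

/-- `G` is a Gorenstein-injective `B`-module: `G` is the kernel at degree `0` of an
exact complex `I•` of injective modules such that `Hom_B(E, I•)` is exact for every
injective module `E`. -/
def IsGInj (G : ModuleCat.{0} B) : Prop :=
  ∃ (I : ℤ → ModuleCat.{0} B) (d : ∀ i : ℤ, I i ⟶ I (i + 1)),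
    (∀ i, Module.Injective B ↥(I i)) ∧
    (∀ i, LinearMap.range (d i).hom = LinearMap.ker (d (i + 1)).hom) ∧
    (∀ (E : ModuleCat.{0} B), Module.Injective B ↥E →
      ∀ (i : ℤ) (φ : E ⟶ I (i + 1)), φ ≫ d (i + 1) = 0 ↔ ∃ ψ : E ⟶ I i, φ = ψ ≫ d i) ∧
    Nonempty (↥G ≃ₗ[B] ↥(LinearMap.ker (d 0).hom))

/-- vanishing of `Ext^n_B(X, Y)` -/
noncomputable def extZero' (n : ℕ) (X Y : ModuleCat.{0} B) : Prop :=
  Subsingleton (((Ext ℤ (ModuleCat.{0} B) n).obj (Opposite.op X)).obj Y)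

/-- `B` is virtually Gorenstein. -/
noncomputable def VirtGorenstein : Prop :=
  ∀ X : ModuleCat.{0} B,
    (∀ G : ModuleCat.{0} B, IsGProj B G → ∀ n : ℕ, 1 ≤ n → extZero' B n G X) ↔
    (∀ E : ModuleCat.{0} B, IsGInj B E → ∀ n : ℕ, 1 ≤ n → extZero' B n X E)

/-- `X` has projective dimension at most `n`. -/
def ProjDimLE : ℕ → ModuleCat.{0} B → Prop
  | 0, X => Module.Projective B X
  | n + 1, X => ∃ (P : ModuleCat.{0} B) (_ : Module.Projective B P) (g : P ⟶ X),
      Function.Surjective g ∧ ProjDimLE n (ModuleCat.of B ↥(LinearMap.ker g.hom))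

/-- `X` has finite projective dimension. -/
def FiniteProjDim (X : ModuleCat.{0} B) : Prop :=
  ∃ n, ProjDimLE B n X

/-- `X` is compactly filtered: it carries an exhaustive ascending chain of submodules
whose subquotients are finitely generated of finite projective dimension. -/
def CompactlyFiltered (X : ModuleCat.{0} B) : Prop :=
  ∃ F : ℕ → Submodule B ↥X,
    Monotone F ∧ F 0 = ⊥ ∧ (⨆ n, F n) = ⊤ ∧
      ∀ n, Module.Finite B
          (↥(F (n + 1)) ⧸ (Submodule.comap (F (n + 1)).subtype (F n))) ∧
        FiniteProjDim B (ModuleCat.of B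
          (↥(F (n + 1)) ⧸ (Submodule.comap (F (n + 1)).subtype (F n))))

/-- `X` is countably generated. -/
def CountablyGenerated (X : ModuleCat.{0} B) : Prop :=
  ∃ s : Set ↥X, s.Countable ∧ Submodule.span B s = ⊤

/-- the subgroup of `Hom_B(X,Y)` generated by morphisms factoring through projectives. -/
def projSub (X Y : ModuleCat.{0} B) : AddSubgroup (X ⟶ Y) :=
  AddSubgroup.closure {f : X ⟶ Y |
    ∃ (P : ModuleCat.{0} B) (_ : Module.Projective B P) (g : X ⟶ P) (h : P ⟶ Y), f = g ≫ h}

/-- the stable Hom-group `StHom_B(X,Y)` modulo projectives. -/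
def StHomP (X Y : ModuleCat.{0} B) : Type :=
  (X ⟶ Y) ⧸ projSub B X Y

instance (X Y : ModuleCat.{0} B) : AddCommGroup (StHomP B X Y) :=
  inferInstanceAs (AddCommGroup ((X ⟶ Y) ⧸ projSub B X Y))

/-- postcomposition as an additive map on Hom-groups. -/
def postCompHom' {Y Z : ModuleCat.{0} B} (X : ModuleCat.{0} B) (h : Y ⟶ Z) :
    (X ⟶ Y) →+ (X ⟶ Z) :=
  AddMonoidHom.mk' (fun f => f ≫ h) (fun f g => by simp [Preadditive.add_comp])

/-- postcomposition descends to the projectively stable Hom-groups. -/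
def stpPostComp (X : ModuleCat.{0} B) {Y Z : ModuleCat.{0} B} (h : Y ⟶ Z) :
    StHomP B X Y →+ StHomP B X Z :=
  QuotientAddGroup.map _ _ (postCompHom' B X h) (by
    rw [projSub, AddSubgroup.closure_le]
    rintro f ⟨P, hP, u, v, rfl⟩
    rw [SetLike.mem_coe, AddSubgroup.mem_comap]
    exact AddSubgroup.subset_closure ⟨P, hP, u, v ≫ h, by simp [postCompHom']⟩)

/-- the canonical map `⊕ᵢ StHom_B(X, Y i) → StHom_B(X, ⊕ᵢ Y i)`. -/
noncomputable def stpCanonMap (X : ModuleCat.{0} B) (I : Type) (Y : I → ModuleCat.{0} B) :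
    DirectSum I (fun i => StHomP B X (Y i)) →+ StHomP B X (∐ Y) :=
  letI : DecidableEq I := Classical.decEq I
  DirectSum.toAddMonoid fun i => stpPostComp B X (Limits.Sigma.ι Y i)

/-- `G` is compactly Gorenstein-projective: `G` is Gorenstein-projective and compact in
the stable category of Gorenstein-projective modules. -/
noncomputable def CompactlyGProj (G : ModuleCat.{0} B) : Prop :=
  IsGProj B G ∧
    ∀ (I : Type) (Z : I → ModuleCat.{0} B), (∀ i, IsGProj B (Z i)) →
      Function.Bijective (stpCanonMap B G I Z)

/-- Condition (CI): the direct sum of countably many finitely generated modules of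
finite projective dimension is right `Ext`-orthogonal to all countably generated,
compactly Gorenstein-projective modules. -/
noncomputable def CondCI : Prop :=
  ∀ Y : ℕ → ModuleCat.{0} B,
    (∀ n, Module.Finite B (Y n) ∧ FiniteProjDim B (Y n)) →
      ∀ G : ModuleCat.{0} B, CountablyGenerated B G → CompactlyGProj B G →
        ∀ i : ℕ, 1 ≤ i → extZero' B i G (∐ Y)

/-- Condition (CII): every compactly Gorenstein-projective, compactly filtered module
is projective. -/
noncomputable def CondCII : Prop :=
  ∀ X : ModuleCat.{0} B, CompactlyGProj B X → CompactlyFiltered B X →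
    Module.Projective B X

/-- `B` has infinite dominant dimension: there is an exact sequence
`0 → B → I⁰ → I¹ → ⋯` with all `Iⁿ` projective-injective. -/
def InfiniteDomDim : Prop :=
  ∃ (I : ℕ → ModuleCat.{0} B) (d0 : ModuleCat.of B B ⟶ I 0) (d : ∀ n, I n ⟶ I (n + 1)),
    (∀ n, Module.Injective B ↥(I n) ∧ Module.Projective B ↥(I n)) ∧
    Function.Injective d0 ∧ LinearMap.range d0.hom = LinearMap.ker (d 0).hom ∧
    ∀ n, LinearMap.range (d n).hom = LinearMap.ker (d (n + 1)).hom

/-- `B` has finite finitistic dimension. -/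
def FiniteFinitisticDim : Prop :=
  ∃ d : ℕ, ∀ X : ModuleCat.{0} B, Module.Finite B X → FiniteProjDim B X → ProjDimLE B d X

end Gorenstein

/-! ## Symmetric algebras -/

section Symm

variable (k : Type) [Field k]

/-- A finite-dimensional `k`-algebra `B` is symmetric if it carries a nondegenerate,
symmetric, associative `k`-bilinear form. -/
def IsSymmetricAlg (B : Type) [Ring B] [Algebra k B] : Prop :=
  ∃ φ : B →ₗ[k] B →ₗ[k] k,
    (∀ x y, φ x y = φ y x) ∧ (∀ x y z, φ (x * y) z = φ x (y * z)) ∧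
    (∀ x, (∀ y, φ x y = 0) → x = 0)

end Symm

section Factorization

variable {R : Type} [Ring R] {X Y Z : Type} [AddCommGroup X] [Module R X]
  [AddCommGroup Y] [Module R Y] [AddCommGroup Z] [Module R Z]

/-- A linear map vanishing on the kernel of a surjection factors through it. -/
lemma exists_comp_eq_of_surjective (f : X →ₗ[R] Y) (hf : Function.Surjective f) (g : X →ₗ[R] Z)
    (h : ∀ x, f x = 0 → g x = 0) : ∃ u : Y →ₗ[R] Z, ∀ x, u (f x) = g x := by
  refine ⟨(LinearMap.ker f).liftQ g (fun x hx => h x hx) ∘ₗ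
    (f.quotKerEquivOfSurjective hf).symm.toLinearMap, fun x => ?_⟩
  have : (f.quotKerEquivOfSurjective hf).symm (f x) = (LinearMap.ker f).mkQ x := by
    rw [LinearEquiv.symm_apply_eq]; rfl
  rw [LinearMap.comp_apply, LinearEquiv.coe_coe, this]
  rfl

/-- A linear map with values in the range of an injection factors through it. -/
lemma exists_comp_eq_of_injective (f : X →ₗ[R] Y) (hf : Function.Injective f) (g : Z →ₗ[R] Y)
    (h : ∀ z, ∃ x, f x = g z) : ∃ u : Z →ₗ[R] X, ∀ z, f (u z) = g z := by
  refine ⟨(LinearEquiv.ofInjective f hf).symm.toLinearMap ∘ₗ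
    g.codRestrict (LinearMap.range f) (fun z => h z), fun z => ?_⟩
  have := LinearEquiv.apply_symm_apply (LinearEquiv.ofInjective f hf)
    (g.codRestrict (LinearMap.range f) (fun z => h z) z)
  exact congrArg Subtype.val this

/-- Extension of linear maps into injective modules. -/
lemma exists_extension_of_injective [Module.Injective R Z] (f : X →ₗ[R] Y)
    (hf : Function.Injective f) (g : X →ₗ[R] Z) : ∃ u : Y →ₗ[R] Z, ∀ x, u (f x) = g x :=
  Module.Injective.out f hf g

/-- Lifting of linear maps from projective modules. -/
lemma exists_lift_of_projective [Module.Projective R Z] (f : X →ₗ[R] Y)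
    (hf : Function.Surjective f) (g : Z →ₗ[R] Y) : ∃ u : Z →ₗ[R] X, ∀ z, f (u z) = g z := by
  obtain ⟨u, hu⟩ := Module.projective_lifting_property f g hf
  exact ⟨u, fun z => congrArg (fun t => t z) hu⟩

end Factorization

section ExtVanishing

variable (B : Type) [Ring B]

/-- Every module has a projective resolution by means of which vanishing of `Ext` is detected. -/
lemma exists_resolution_extZero'_iff (X : ModuleCat.{0} B) :
    ∃ (Q : ℕ → ModuleCat.{0} B) (d : ∀ n, Q (n + 1) →ₗ[B] Q n) (ε : Q 0 →ₗ[B] X),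
      (∀ n, Module.Projective B (Q n)) ∧ Function.Surjective ε ∧
      Function.Exact (d 0) ε ∧ (∀ n, Function.Exact (d (n + 1)) (d n)) ∧
      ∀ (n : ℕ) (Y : ModuleCat.{0} B), extZero' B (n + 1) X Y ↔
        ∀ f : Q (n + 1) →ₗ[B] Y, (∀ x, f (d (n + 1) x) = 0) →
          ∃ g : Q n →ₗ[B] Y, ∀ x, g (d n x) = f x := by
  let P := ProjectiveResolution.of X
  refine ⟨P.complex.X, fun n => (P.complex.d (n + 1) n).hom, (P.π.f 0).hom, fun n => ?_, ?_, ?_,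
    ?_, ?_⟩
  · exact (IsProjective.iff_projective _).2 (P.projective n)
  · exact (ModuleCat.epi_iff_surjective (P.π.f 0)).1 inferInstance
  · exact (ShortComplex.ShortExact.moduleCat_exact_iff_function_exact _).1 P.exact₀
  · intro n
    exact (ShortComplex.ShortExact.moduleCat_exact_iff_function_exact _).1 (P.exact_succ n)
  · intro n Y
    have e := P.isoExt (R := ℤ) (n + 1) Y
    have h1 : extZero' B (n + 1) X Y ↔ (P.complex.linearYonedaObj ℤ Y).ExactAt (n + 1) := by
      rw [HomologicalComplex.exactAt_iff_isZero_homology, ← e.isZero_iff,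
        ModuleCat.isZero_iff_subsingleton]
      rfl
    rw [h1, HomologicalComplex.exactAt_iff' _ n (n + 1) (n + 2) (by simp) (by simp),
      ShortComplex.moduleCat_exact_iff]
    constructor
    · intro h f hf
      obtain ⟨g, hg⟩ := h (ModuleCat.ofHom f) (by
        change P.complex.d (n + 2) (n + 1) ≫ ModuleCat.ofHom f = 0
        ext x
        exact hf x)
      refine ⟨(show P.complex.X n ⟶ Y from g).hom, fun x => ?_⟩
      change P.complex.d (n + 1) n ≫ (g : P.complex.X n ⟶ Y) = ModuleCat.ofHom f at hg
      exact congrArg (fun t => ModuleCat.Hom.hom t x) hg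
    · intro h (f : P.complex.X (n + 1) ⟶ Y) hf
      change P.complex.d (n + 2) (n + 1) ≫ f = 0 at hf
      obtain ⟨g, hg⟩ := h f.hom (fun x => congrArg (fun t => ModuleCat.Hom.hom t x) hf)
      refine ⟨(ModuleCat.ofHom g : P.complex.X n ⟶ Y), ?_⟩
      change P.complex.d (n + 1) n ≫ ModuleCat.ofHom g = f
      ext x
      exact hg x

/-- If `Ext¹(G, X) = 0`, then maps to `X` extend along monomorphisms with cokernel `G`. -/
lemma exists_extension_of_extZero' {K P : Type} [AddCommGroup K] [Module B K] [AddCommGroup P]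
    [Module B P] {G X : ModuleCat.{0} B} (h : extZero' B 1 G X) (i : K →ₗ[B] P) (p : P →ₗ[B] G)
    (hi : Function.Injective i) (hp : Function.Surjective p) (hex : Function.Exact i p)
    (f : K →ₗ[B] X) : ∃ u : P →ₗ[B] X, ∀ x, u (i x) = f x := by
  obtain ⟨Q, d, ε, hQ, hε, h0, hd, hext⟩ := exists_resolution_extZero'_iff B G
  obtain ⟨a, ha⟩ := exists_lift_of_projective p hp ε
  obtain ⟨b, hb⟩ := exists_comp_eq_of_injective i hi (a ∘ₗ d 0) (fun z => by
    refine (hex _).1 ?_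
    simp only [LinearMap.comp_apply, ha]
    exact (h0 _).2 ⟨z, rfl⟩)
  obtain ⟨g, hg⟩ := (hext 0 X).1 h (f ∘ₗ b) (fun x => by
    have : b (d 1 x) = 0 := hi (by
      rw [hb, map_zero]
      simp [(hd 0 _).2 ⟨x, rfl⟩])
    simp [this])
  obtain ⟨u, hu⟩ := exists_comp_eq_of_surjective (LinearMap.coprod a i) (by
      intro y
      obtain ⟨q, hq⟩ := hε (p y)
      obtain ⟨x, hx⟩ := (hex (y - a q)).1 (by simp [ha, hq])
      exact ⟨(q, x), by simp [hx]⟩)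
    (LinearMap.coprod g f) (by
      rintro ⟨q, x⟩ hqx
      simp only [LinearMap.coprod_apply] at hqx ⊢
      have h1 : ε q = 0 := by
        have := congrArg p hqx
        rwa [map_add, ha, (hex (i x)).2 ⟨x, rfl⟩, add_zero, map_zero] at this
      obtain ⟨z, rfl⟩ := (h0 q).1 h1
      have h2 : b z + x = 0 := hi (by rw [map_add, hb, map_zero]; exact hqx)
      rw [hg, LinearMap.comp_apply, ← map_add, h2, map_zero])
  exact ⟨u, fun x => by simpa using hu (0, x)⟩

end ExtVanishing

section LeftOrthogonal

variable (B : Type) [Ring B]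

/-- Exact complexes of injective modules, indexed by the integers. -/
structure IsAcyclicInj (I : ℤ → ModuleCat.{0} B) (d : ∀ i : ℤ, I i →ₗ[B] I (i + 1)) :
    Prop where
  injective : ∀ i, Module.Injective B (I i)
  exact : ∀ i, Function.Exact (d i) (d (i + 1))

/-- `Hom(X, I•)` is exact for all exact complexes `I•` of injective modules. -/
def IsLeftOrthAcyclic (X : ModuleCat.{0} B) : Prop :=
  ∀ (I : ℤ → ModuleCat.{0} B) (d : ∀ i : ℤ, I i →ₗ[B] I (i + 1)), IsAcyclicInj B I d →
    ∀ (i : ℤ) (φ : X →ₗ[B] I (i + 1)), (∀ x, d (i + 1) (φ x) = 0) →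
      ∃ ψ : X →ₗ[B] I i, ∀ x, d i (ψ x) = φ x

variable {B}

lemma IsLeftOrthAcyclic.extZero'_of_isGInj {X : ModuleCat.{0} B} (hX : IsLeftOrthAcyclic B X)
    (E : ModuleCat.{0} B) (hE : IsGInj B E) (n : ℕ) (hn : 1 ≤ n) : extZero' B n X E := by
  obtain ⟨I, d', hI, hex, -, ⟨e⟩⟩ := hE
  obtain ⟨d, rfl⟩ : ∃ d : ∀ i : ℤ, I i →ₗ[B] I (i + 1), d' = fun i => ModuleCat.ofHom (d i) :=
    ⟨fun i => (d' i).hom, rfl⟩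
  have hT : IsAcyclicInj B I d := ⟨hI, fun i => LinearMap.exact_iff.2 (hex i).symm⟩
  obtain ⟨Q, δ, ε, hQ, hε, h0, hδ, hext⟩ := exists_resolution_extZero'_iff B X
  have key : ∀ (n : ℕ) (i : ℤ) (f : Q (n + 1) →ₗ[B] I i), (∀ x, d i (f x) = 0) →
      (∀ x, f (δ (n + 1) x) = 0) →
      ∃ g : Q n →ₗ[B] I i, (∀ x, d i (g x) = 0) ∧ ∀ x, g (δ n x) = f x := by
    intro n
    induction n with
    | zero =>
      intro i f hdf hf
      have := hT.injective i
      obtain ⟨f₁, hf₁⟩ := exists_comp_eq_of_surjective (δ 0).rangeRestrict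
        (δ 0).surjective_rangeRestrict f (fun x hx => by
          obtain ⟨y, rfl⟩ := (hδ 0 x).1 (congrArg Subtype.val hx)
          exact hf y)
      obtain ⟨g₀, hg₀⟩ := exists_extension_of_injective (LinearMap.range (δ 0)).subtype
        (Submodule.injective_subtype _) f₁
      have hg₀' : ∀ x, g₀ (δ 0 x) = f x := fun x => (hg₀ ((δ 0).rangeRestrict x)).trans (hf₁ x)
      obtain ⟨φ, hφ⟩ := exists_comp_eq_of_surjective ε hε (d i ∘ₗ g₀) (fun x hx => by
        obtain ⟨y, rfl⟩ := (h0 x).1 hx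
        simp [hg₀', hdf])
      obtain ⟨ψ, hψ⟩ := hX I d hT i φ (fun x => by
        obtain ⟨y, rfl⟩ := hε x
        rw [hφ]
        exact (hT.exact i _).2 ⟨_, rfl⟩)
      refine ⟨g₀ - ψ ∘ₗ ε, fun x => ?_, fun x => ?_⟩
      · simp [hψ, hφ]
      · simp [hg₀', (h0 _).2 ⟨x, rfl⟩]
    | succ m ih =>
      intro i f hdf hf
      have := hT.injective i
      obtain ⟨f₁, hf₁⟩ := exists_comp_eq_of_surjective (δ (m + 1)).rangeRestrict
        (δ (m + 1)).surjective_rangeRestrict f (fun x hx => by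
          obtain ⟨y, rfl⟩ := (hδ (m + 1) x).1 (congrArg Subtype.val hx)
          exact hf y)
      obtain ⟨g₀, hg₀⟩ := exists_extension_of_injective (LinearMap.range (δ (m + 1))).subtype
        (Submodule.injective_subtype _) f₁
      have hg₀' : ∀ x, g₀ (δ (m + 1) x) = f x :=
        fun x => (hg₀ ((δ (m + 1)).rangeRestrict x)).trans (hf₁ x)
      obtain ⟨g₁, hg₁, hg₁'⟩ := ih (i + 1) (d i ∘ₗ g₀) (fun x => (hT.exact i _).2 ⟨_, rfl⟩)
        (fun x => by simp [hg₀', hdf])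
      have := hQ m
      obtain ⟨h, hh⟩ := exists_lift_of_projective (d i).rangeRestrict
        (d i).surjective_rangeRestrict
        (g₁.codRestrict (LinearMap.range (d i)) (fun x => (hT.exact i _).1 (hg₁ x)))
      have hh' : ∀ x, d i (h x) = g₁ x := fun x => congrArg Subtype.val (hh x)
      refine ⟨g₀ - h ∘ₗ δ m, fun x => ?_, fun x => ?_⟩
      · simp [hh', hg₁']
      · simp [hg₀', (hδ m _).2 ⟨x, rfl⟩]
  obtain ⟨m, rfl⟩ : ∃ m, n = m + 1 := ⟨n - 1, by omega⟩
  rw [hext]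
  intro f hf
  obtain ⟨g, hg, hgf⟩ := key m 0 ((LinearMap.ker (d 0)).subtype ∘ₗ e.toLinearMap ∘ₗ f)
    (fun x => (e (f x)).2) (fun x => by simp [hf])
  refine ⟨e.symm.toLinearMap ∘ₗ g.codRestrict (LinearMap.ker (d 0)) hg, fun x => ?_⟩
  simp only [LinearMap.comp_apply, LinearEquiv.coe_coe]
  rw [LinearEquiv.symm_apply_eq]
  exact Subtype.ext (hgf x)

/-- A virtually Gorenstein ring: `Ext¹` from Gorenstein-projective modules vanishes on modules
left orthogonal to exact complexes of injective modules. -/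
lemma IsLeftOrthAcyclic.extZero'_of_isGProj (hB : VirtGorenstein B) {X : ModuleCat.{0} B}
    (hX : IsLeftOrthAcyclic B X) {G : ModuleCat.{0} B} (hG : IsGProj B G) : extZero' B 1 G X :=
  (hB X).2 (fun E hE n hn => hX.extZero'_of_isGInj E hE n hn) G hG 1 le_rfl

lemma IsLeftOrthAcyclic.of_projective (X : ModuleCat.{0} B) [Module.Projective B X] :
    IsLeftOrthAcyclic B X := by
  intro I d hT i φ hφ
  obtain ⟨h, hh⟩ := exists_lift_of_projective (d i).rangeRestrict
    (d i).surjective_rangeRestrict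
    (φ.codRestrict (LinearMap.range (d i)) (fun x => (hT.exact i _).1 (hφ x)))
  exact ⟨h, fun x => congrArg Subtype.val (hh x)⟩

lemma IsLeftOrthAcyclic.dfinsupp {S : Type} (X : S → ModuleCat.{0} B)
    (hX : ∀ s, IsLeftOrthAcyclic B (X s)) : IsLeftOrthAcyclic B (ModuleCat.of B (Π₀ s, X s)) := by
  classical
  intro I d hT i φ hφ
  choose ψ hψ using fun s => hX s I d hT i
    (φ ∘ₗ DFinsupp.lsingle (R := B) (M := fun s => X s) s) (fun x => hφ _)
  refine ⟨DFinsupp.lsum ℕ ψ, fun x => ?_⟩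
  have : d i ∘ₗ DFinsupp.lsum ℕ ψ = φ := by
    refine DFinsupp.lhom_ext' fun s => ?_
    ext x
    simp [hψ]
  exact congrArg (fun t => t x) this

lemma IsLeftOrthAcyclic.of_extension {X Y W : ModuleCat.{0} B} (f : X →ₗ[B] Y) (g : Y →ₗ[B] W)
    (hf : Function.Injective f) (hg : Function.Surjective g) (hfg : Function.Exact f g)
    (hX : IsLeftOrthAcyclic B X) (hW : IsLeftOrthAcyclic B W) : IsLeftOrthAcyclic B Y := by
  intro I d hT i φ hφ
  have := hT.injective i
  obtain ⟨ψ, hψ⟩ := hX I d hT i (φ ∘ₗ f) (fun x => hφ _)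
  obtain ⟨ψ', hψ'⟩ := exists_extension_of_injective f hf ψ
  obtain ⟨χ, hχ⟩ := exists_comp_eq_of_surjective g hg (φ - d i ∘ₗ ψ') (fun y hy => by
    obtain ⟨x, rfl⟩ := (hfg y).1 hy
    simp [hψ', hψ])
  obtain ⟨χ', hχ'⟩ := hW I d hT i χ (fun w => by
    obtain ⟨y, rfl⟩ := hg w
    simp [hχ, hφ, (hT.exact i _).2 ⟨_, rfl⟩])
  exact ⟨ψ' + χ' ∘ₗ g, fun y => by simp [hχ', hχ]⟩

lemma IsLeftOrthAcyclic.of_cokernel {X Y W : ModuleCat.{0} B} (f : X →ₗ[B] Y) (g : Y →ₗ[B] W)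
    (hf : Function.Injective f) (hg : Function.Surjective g) (hfg : Function.Exact f g)
    (hX : IsLeftOrthAcyclic B X) (hY : IsLeftOrthAcyclic B Y) : IsLeftOrthAcyclic B W := by
  intro I d hT i φ hφ
  obtain ⟨j, rfl⟩ : ∃ j, i = j + 1 := ⟨i - 1, by ring⟩
  have := hT.injective j
  obtain ⟨ψ, hψ⟩ := hY I d hT (j + 1) (φ ∘ₗ g) (fun x => hφ _)
  obtain ⟨χ, hχ⟩ := hX I d hT j (ψ ∘ₗ f) (fun x => by
    simp [hψ, (hfg _).2 ⟨x, rfl⟩])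
  obtain ⟨χ', hχ'⟩ := exists_extension_of_injective f hf χ
  obtain ⟨u, hu⟩ := exists_comp_eq_of_surjective g hg (ψ - d j ∘ₗ χ') (fun y hy => by
    obtain ⟨x, rfl⟩ := (hfg y).1 hy
    simp [hχ', hχ])
  refine ⟨u, fun w => ?_⟩
  obtain ⟨y, rfl⟩ := hg w
  simp [hu, hψ, (hT.exact j _).2 ⟨_, rfl⟩]

end LeftOrthogonal

section DirectSums

variable {B : Type} [Ring B] {S : Type}

/-- Over a noetherian ring, direct sums of injective modules are injective. -/
lemma injective_dfinsupp [IsNoetherianRing B] (J : S → ModuleCat.{0} B)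
    (hJ : ∀ s, Module.Injective B (J s)) : Module.Injective B (Π₀ s, J s) := by
  classical
  refine Module.Baer.injective fun I g => ?_
  obtain ⟨t, ht⟩ := (isNoetherian_def.1 inferInstance I : I.FG)
  have htI : ∀ x ∈ t, x ∈ I := fun x hx => ht ▸ Submodule.subset_span hx
  let F : Finset S := t.attach.biUnion fun x => (g ⟨x.1, htI x.1 x.2⟩).support
  choose h hh using fun s => Module.Baer.of_injective (hJ s) I
    (DFinsupp.lapply (R := B) (M := fun s => J s) s ∘ₗ g)
  let e : Π₀ s, J s := DFinsupp.mk F fun s => h s.1 1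
  refine ⟨LinearMap.toSpanSingleton B _ e, ?_⟩
  have hF : ∀ x (hx : x ∈ I), ∀ s ∉ F, g ⟨x, hx⟩ s = 0 := by
    intro x hx s hs
    have hle : Submodule.span B (t : Set B) ≤ Submodule.map I.subtype
        (LinearMap.ker (DFinsupp.lapply (R := B) (M := fun s => J s) s ∘ₗ g)) := by
      rw [Submodule.span_le]
      intro y hy
      refine ⟨⟨y, htI y hy⟩, ?_, rfl⟩
      by_contra hne
      exact hs (Finset.mem_biUnion.2 ⟨⟨y, hy⟩, Finset.mem_attach _ _, by simpa using hne⟩)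
    rw [ht] at hle
    obtain ⟨z, hz, hzx⟩ := hle hx
    obtain rfl : z = ⟨x, hx⟩ := Subtype.ext hzx
    exact hz
  intro x hx
  ext s
  by_cases hs : s ∈ F
  · have h1 : h s x = g ⟨x, hx⟩ s := hh s x hx
    rw [← h1, LinearMap.toSpanSingleton_apply, DFinsupp.smul_apply, DFinsupp.mk_of_mem hs,
      ← map_smul, smul_eq_mul, mul_one]
  · rw [hF x hx s hs, LinearMap.toSpanSingleton_apply, DFinsupp.smul_apply,
      DFinsupp.mk_of_notMem hs, smul_zero]

variable {X Y Z : S → ModuleCat.{0} B}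

lemma dfinsupp_mapRange_injective (f : ∀ s, X s →ₗ[B] Y s) (hf : ∀ s, Function.Injective (f s)) :
    Function.Injective (DFinsupp.mapRange.linearMap f) := by
  intro x y hxy
  ext s
  exact hf s (by simpa using DFunLike.congr_fun hxy s)

lemma dfinsupp_mapRange_surjective (f : ∀ s, X s →ₗ[B] Y s)
    (hf : ∀ s, Function.Surjective (f s)) :
    Function.Surjective (DFinsupp.mapRange.linearMap f) := by
  classical
  intro y
  have : ∀ s (v : Y s), ∃ u : X s, f s u = v ∧ (v = 0 → u = 0) := fun s v => by
    by_cases hv : v = 0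
    · exact ⟨0, by simp [hv], fun _ => rfl⟩
    · obtain ⟨u, hu⟩ := hf s v
      exact ⟨u, hu, fun h => absurd h hv⟩
  choose u hu hu0 using this
  refine ⟨y.mapRange u fun s => hu0 s 0 rfl, ?_⟩
  ext s
  simp [hu]

lemma dfinsupp_mapRange_exact (f : ∀ s, X s →ₗ[B] Y s) (g : ∀ s, Y s →ₗ[B] Z s)
    (hfg : ∀ s, Function.Exact (f s) (g s)) :
    Function.Exact (DFinsupp.mapRange.linearMap f) (DFinsupp.mapRange.linearMap g) := by
  classical
  intro y
  constructor
  · intro hy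
    have hy' : ∀ s, g s (y s) = 0 := fun s => by simpa using DFunLike.congr_fun hy s
    have : ∀ s (v : Y s), ∃ u : X s, (g s v = 0 → f s u = v) ∧ (v = 0 → u = 0) := fun s v => by
      by_cases hv : v = 0
      · exact ⟨0, by simp [hv], fun _ => rfl⟩
      · by_cases hg : g s v = 0
        · obtain ⟨u, hu⟩ := (hfg s v).1 hg
          exact ⟨u, fun _ => hu, fun h => absurd h hv⟩
        · exact ⟨0, fun h => absurd h hg, fun _ => rfl⟩
    choose u hu hu0 using this
    refine ⟨y.mapRange u fun s => hu0 s 0 rfl, ?_⟩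
    ext s
    simp [hu s _ (hy' s)]
  · rintro ⟨x, rfl⟩
    ext s
    simpa using (hfg s _).2 ⟨x s, rfl⟩

end DirectSums

section Coresolutions

variable (B : Type) [Ring B]

/-- There is a short exact sequence `0 → X → J → Y → 0` with `J` projective-injective. -/
def CoresStep (X Y : ModuleCat.{0} B) : Prop :=
  ∃ (J : ModuleCat.{0} B) (f : X →ₗ[B] J) (g : J →ₗ[B] Y), Module.Projective B J ∧
    Module.Injective B J ∧ Function.Injective f ∧ Function.Surjective g ∧ Function.Exact f g

/-- `X` has infinite dominant dimension: it admits a coresolution by projective-injective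
modules. -/
def HasProjInjCores (X : ModuleCat.{0} B) : Prop :=
  ∃ S : ModuleCat.{0} B → Prop, S X ∧ ∀ Z, S Z → ∃ Y, S Y ∧ CoresStep B Z Y

variable {B}

lemma HasProjInjCores.step {X : ModuleCat.{0} B} (h : HasProjInjCores B X) :
    ∃ Y, HasProjInjCores B Y ∧ CoresStep B X Y := by
  obtain ⟨S, hX, hS⟩ := h
  obtain ⟨Y, hY, hXY⟩ := hS X hX
  exact ⟨Y, ⟨S, hY, hS⟩, hXY⟩

lemma HasProjInjCores.of_step {X Y : ModuleCat.{0} B} (h : CoresStep B X Y)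
    (hY : HasProjInjCores B Y) : HasProjInjCores B X := by
  refine ⟨fun Z => ∃ Y, HasProjInjCores B Y ∧ CoresStep B Z Y, ⟨Y, hY, h⟩, ?_⟩
  rintro Z ⟨W, hW, hZW⟩
  exact ⟨W, hW.step, hZW⟩

lemma HasProjInjCores.of_equiv {X X' : ModuleCat.{0} B} (e : X ≃ₗ[B] X')
    (h : HasProjInjCores B X) : HasProjInjCores B X' := by
  obtain ⟨Y, hY, J, f, g, h1, h2, h3, h4, h5⟩ := h.step
  refine HasProjInjCores.of_step ⟨J, f ∘ₗ e.symm.toLinearMap, g, h1, h2,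
    h3.comp e.symm.injective, h4, ?_⟩ hY
  intro y
  rw [h5 y]
  constructor
  · rintro ⟨x, rfl⟩
    exact ⟨e x, by simp⟩
  · rintro ⟨x, rfl⟩
    exact ⟨e.symm x, rfl⟩

lemma HasProjInjCores.of_projective_injective (X : ModuleCat.{0} B) [h₁ : Module.Projective B X]
    [h₂ : Module.Injective B X] : HasProjInjCores B X := by
  have hzero : HasProjInjCores B (ModuleCat.of B PUnit) := by
    refine ⟨fun Z => Z = ModuleCat.of B PUnit, rfl, ?_⟩
    rintro _ rfl
    refine ⟨_, rfl, ModuleCat.of B PUnit, LinearMap.id, LinearMap.id, ?_, ?_,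
      Function.injective_id, Function.surjective_id, ?_⟩
    · change Module.Projective B PUnit
      infer_instance
    · exact ⟨fun X Y _ _ _ _ f hf g => ⟨0, fun x => rfl⟩⟩
    · intro x
      exact ⟨fun _ => ⟨x, rfl⟩, fun _ => rfl⟩
  exact HasProjInjCores.of_step ⟨X, LinearMap.id, 0, h₁, h₂, Function.injective_id,
    fun x => ⟨0, rfl⟩, fun x => ⟨fun _ => ⟨x, rfl⟩, fun _ => rfl⟩⟩ hzero

lemma injective_prod {X Y : Type} [AddCommGroup X] [Module B X] [AddCommGroup Y] [Module B Y]
    [Module.Injective B X] [Module.Injective B Y] : Module.Injective B (X × Y) := by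
  refine ⟨fun P Q _ _ _ _ f hf g => ?_⟩
  obtain ⟨u, hu⟩ := exists_extension_of_injective f hf (LinearMap.fst B X Y ∘ₗ g)
  obtain ⟨v, hv⟩ := exists_extension_of_injective f hf (LinearMap.snd B X Y ∘ₗ g)
  exact ⟨u.prod v, fun x => Prod.ext (hu x) (hv x)⟩

lemma HasProjInjCores.of_extension {X Z Y : ModuleCat.{0} B} (i : X →ₗ[B] Z) (p : Z →ₗ[B] Y)
    (hi : Function.Injective i) (hp : Function.Surjective p) (hip : Function.Exact i p)
    (hX : HasProjInjCores B X) (hY : HasProjInjCores B Y) : HasProjInjCores B Z := by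
  refine ⟨fun Z => ∃ (X Y : ModuleCat.{0} B) (i : X →ₗ[B] Z) (p : Z →ₗ[B] Y),
    Function.Injective i ∧ Function.Surjective p ∧ Function.Exact i p ∧
    HasProjInjCores B X ∧ HasProjInjCores B Y, ⟨X, Y, i, p, hi, hp, hip, hX, hY⟩, ?_⟩
  rintro Z ⟨X, Y, i, p, hi, hp, hip, hX, hY⟩
  obtain ⟨X', hX', J, a, b, hJp, hJi, ha, hb, hab⟩ := hX.step
  obtain ⟨Y', hY', K, c, d, hKp, hKi, hc, hd, hcd⟩ := hY.step
  obtain ⟨a', ha'⟩ := exists_extension_of_injective i hi a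
  let φ : Z →ₗ[B] (J × K) := a'.prod (c ∘ₗ p)
  have hφ : Function.Injective φ := by
    rw [injective_iff_map_eq_zero]
    intro z hz
    have h2 : c (p z) = 0 := congrArg Prod.snd hz
    obtain ⟨x, rfl⟩ := (hip z).1 (hc (by rw [h2, map_zero]))
    have h1 : a' (i x) = 0 := congrArg Prod.fst hz
    rw [ha'] at h1
    rw [ha (h1.trans (map_zero a).symm), map_zero]
  let Q := ModuleCat.of B ((J × K) ⧸ LinearMap.range φ)
  let q : (J × K) →ₗ[B] Q := (LinearMap.range φ).mkQ
  have hq : ∀ v, q v = 0 ↔ ∃ z, φ z = v := fun v => by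
    rw [← LinearMap.mem_range]
    exact Submodule.Quotient.mk_eq_zero _
  have hqs : Function.Surjective q := Submodule.mkQ_surjective _
  obtain ⟨u, hu⟩ := exists_comp_eq_of_surjective b hb (q ∘ₗ LinearMap.inl B J K) (fun j hj => by
    obtain ⟨x, rfl⟩ := (hab j).1 hj
    refine (hq _).2 ⟨i x, ?_⟩
    exact Prod.ext (ha' x) (by simp [φ, (hip _).2 ⟨x, rfl⟩]))
  obtain ⟨v, hv⟩ := exists_comp_eq_of_surjective q hqs (d ∘ₗ LinearMap.snd B J K) (fun w hw => by
    obtain ⟨z, rfl⟩ := (hq w).1 hw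
    exact (hcd _).2 ⟨p z, rfl⟩)
  refine ⟨Q, ⟨X', Y', u, v, ?_, ?_, ?_, hX', hY'⟩, ModuleCat.of B (J × K), φ, q, ?_,
    injective_prod, hφ, hqs, fun w => ?_⟩
  · rw [injective_iff_map_eq_zero]
    intro x hx
    obtain ⟨j, rfl⟩ := hb x
    rw [hu] at hx
    obtain ⟨z, hz⟩ := (hq _).1 hx
    have h2 : c (p z) = 0 := congrArg Prod.snd hz
    obtain ⟨x, rfl⟩ := (hip z).1 (hc (by rw [h2, map_zero]))
    have h1 : a' (i x) = j := congrArg Prod.fst hz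
    rw [← h1, ha']
    exact (hab _).2 ⟨x, rfl⟩
  · intro y
    obtain ⟨k, rfl⟩ := hd y
    exact ⟨q (0, k), by simp [hv]⟩
  · intro w
    obtain ⟨⟨j, k⟩, rfl⟩ := hqs w
    rw [hv]
    constructor
    · intro hk
      obtain ⟨y, hy⟩ := (hcd k).1 hk
      obtain ⟨z, rfl⟩ := hp y
      refine ⟨b (j - a' z), ?_⟩
      rw [hu, LinearMap.comp_apply, ← sub_eq_zero, ← map_sub]
      refine (hq _).2 ⟨-z, ?_⟩
      simp [φ, hy]
    · rintro ⟨x, hx⟩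
      obtain ⟨j', rfl⟩ := hb x
      rw [hu] at hx
      have := congrArg v hx
      rw [LinearMap.comp_apply, hv, hv] at this
      simpa using this.symm
  · change Module.Projective B (J × K)
    infer_instance
  · exact hq w

lemma HasProjInjCores.of_prod {J W : ModuleCat.{0} B} [Module.Projective B J]
    [Module.Injective B J] (h : HasProjInjCores B (ModuleCat.of B (J × W))) :
    HasProjInjCores B W := by
  obtain ⟨Z, hZ, J₀, a, b, hp, hi, ha, hb, hab⟩ := h.step
  change (J × W) →ₗ[B] J₀ at a
  obtain ⟨r, hr⟩ := exists_extension_of_injective a ha (LinearMap.fst B J W)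
  have hJZ : HasProjInjCores B (ModuleCat.of B (J × Z)) :=
    HasProjInjCores.of_extension (X := J) (Z := ModuleCat.of B (J × Z)) (Y := Z)
      (LinearMap.inl B J Z) (LinearMap.snd B J Z) LinearMap.inl_injective
      LinearMap.snd_surjective (Function.Exact.inl_snd) (.of_projective_injective J) hZ
  refine HasProjInjCores.of_step ⟨J₀, a ∘ₗ LinearMap.inr B J W, r.prod b, hp, hi,
    ha.comp LinearMap.inr_injective, ?_, ?_⟩ hJZ
  · rintro ⟨j, z⟩
    obtain ⟨x, rfl⟩ := hb z
    refine ⟨x + a (j - r x, 0), ?_⟩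
    have h1 : b (a (j - r x, 0)) = 0 := (hab _).2 ⟨_, rfl⟩
    refine Prod.ext ?_ ?_
    · simp [hr]
    · simp [h1]
  · intro x
    constructor
    · intro hx
      obtain ⟨⟨j, w⟩, rfl⟩ := (hab x).1 (congrArg Prod.snd hx)
      have h1 : r (a (j, w)) = 0 := congrArg Prod.fst hx
      rw [hr] at h1
      obtain rfl : j = 0 := h1
      exact ⟨w, rfl⟩
    · rintro ⟨w, rfl⟩
      refine Prod.ext ?_ ?_
      · simp [hr]
      · exact (hab _).2 ⟨_, rfl⟩

lemma HasProjInjCores.of_cokernel {X Y W : ModuleCat.{0} B} (f : X →ₗ[B] Y) (g : Y →ₗ[B] W)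
    (hf : Function.Injective f) (hg : Function.Surjective g) (hfg : Function.Exact f g)
    (hX : HasProjInjCores B X) (hY : HasProjInjCores B Y) : HasProjInjCores B W := by
  obtain ⟨X', hX', J, a, b, hp, hi, ha, hb, hab⟩ := hX.step
  obtain ⟨a', ha'⟩ := exists_extension_of_injective f hf a
  obtain ⟨c, hc⟩ := exists_comp_eq_of_surjective g hg (b ∘ₗ a') (fun y hy => by
    obtain ⟨x, rfl⟩ := (hfg y).1 hy
    simp only [LinearMap.comp_apply, ha']
    exact (hab _).2 ⟨x, rfl⟩)
  refine HasProjInjCores.of_prod (J := J)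
    (HasProjInjCores.of_extension (X := Y) (Z := ModuleCat.of B (J × W)) (Y := X')
      (a'.prod g) (b.coprod (-c)) ?_ ?_ ?_ hY hX')
  · rw [injective_iff_map_eq_zero]
    intro y hy
    obtain ⟨x, rfl⟩ := (hfg y).1 (congrArg Prod.snd hy)
    have h1 : a' (f x) = 0 := congrArg Prod.fst hy
    rw [ha'] at h1
    rw [ha (h1.trans (map_zero a).symm), map_zero]
  · intro z
    obtain ⟨j, rfl⟩ := hb z
    exact ⟨(j, 0), by simp⟩
  · rintro ⟨j, w⟩
    obtain ⟨y, rfl⟩ := hg w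
    have hval : (b.coprod (-c)) (j, g y) = b (j - a' y) := by
      simp [hc, sub_eq_add_neg]
    constructor
    · intro h
      obtain ⟨x, hx⟩ := (hab _).1 (hval.symm.trans h)
      refine ⟨y + f x, Prod.ext ?_ ?_⟩
      · simp [ha', hx]
      · simp [(hfg _).2 ⟨x, rfl⟩]
    · rintro ⟨y', hy'⟩
      have h1 : a' y' = j := congrArg Prod.fst hy'
      have h2 : g y' = g y := congrArg Prod.snd hy'
      refine hval.trans ?_
      rw [map_sub, ← h1]
      have := hc y
      rw [← h2, hc] at this
      exact sub_eq_zero.2 this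

lemma HasProjInjCores.dfinsupp [IsNoetherianRing B] {S : Type} (X : S → ModuleCat.{0} B)
    (hX : ∀ s, HasProjInjCores B (X s)) : HasProjInjCores B (ModuleCat.of B (Π₀ s, X s)) := by
  refine ⟨fun Z => ∃ X : S → ModuleCat.{0} B, (∀ s, HasProjInjCores B (X s)) ∧
    Z = ModuleCat.of B (Π₀ s, X s), ⟨X, hX, rfl⟩, ?_⟩
  rintro _ ⟨X, hX, rfl⟩
  choose Y hY J f g hp hi hf hg hfg using fun s => (hX s).step
  refine ⟨_, ⟨Y, hY, rfl⟩, ModuleCat.of B (Π₀ s, J s), DFinsupp.mapRange.linearMap f,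
    DFinsupp.mapRange.linearMap g, ?_, injective_dfinsupp J hi, dfinsupp_mapRange_injective f hf,
    dfinsupp_mapRange_surjective g hg, dfinsupp_mapRange_exact f g hfg⟩
  change Module.Projective B (Π₀ s, J s)
  infer_instance

end Coresolutions

section GorensteinProjective

lemma exists_int_sequence {α : Type*} (R : α → α → Prop) (hr : ∀ a, ∃ b, R a b)
    (hl : ∀ b, ∃ a, R a b) (x : α) : ∃ Z : ℤ → α, Z 0 = x ∧ ∀ i, R (Z i) (Z (i + 1)) := by
  choose r hr using hr
  choose l hl using hl
  refine ⟨fun i => match i with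
    | .ofNat n => r^[n] x
    | .negSucc n => l^[n + 1] x, rfl, ?_⟩
  rintro (n | n)
  · change R (r^[n] x) (r^[n + 1] x)
    rw [Function.iterate_succ_apply']
    exact hr _
  · cases n with
    | zero => exact hl x
    | succ n =>
      change R (l^[n + 2] x) (l^[n + 1] x)
      rw [Function.iterate_succ_apply' l (n + 1)]
      exact hl _

variable (B : Type) [Ring B]

/-- A short exact sequence `0 → X → P → Y → 0` with `P` projective such that every map `X → B`
extends to `P`. -/
def GorStep (X Y : ModuleCat.{0} B) : Prop :=
  ∃ (P : ModuleCat.{0} B) (f : X →ₗ[B] P) (g : P →ₗ[B] Y), Module.Projective B P ∧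
    Function.Injective f ∧ Function.Surjective g ∧ Function.Exact f g ∧
    ∀ φ : X →ₗ[B] B, ∃ ψ : P →ₗ[B] B, ∀ x, ψ (f x) = φ x

variable {B}

lemma isGProj_of_gorStep (S : ModuleCat.{0} B → Prop) (hr : ∀ X, S X → ∃ Y, S Y ∧ GorStep B X Y)
    (hl : ∀ Y, S Y → ∃ X, S X ∧ GorStep B X Y) {X : ModuleCat.{0} B} (hX : S X) :
    IsGProj B X := by
  obtain ⟨Z, hZ0, hZ⟩ := exists_int_sequence (α := {X // S X}) (fun X Y => GorStep B X.1 Y.1)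
    (fun X => by obtain ⟨Y, hY, h⟩ := hr X.1 X.2; exact ⟨⟨Y, hY⟩, h⟩)
    (fun Y => by obtain ⟨X, hX, h⟩ := hl Y.1 Y.2; exact ⟨⟨X, hX⟩, h⟩) ⟨X, hX⟩
  choose P f g hP hf hg hfg hext using hZ
  have hd : ∀ i (x : P i), f (i + 1) (g i x) = 0 ↔ g i x = 0 := fun i x =>
    map_eq_zero_iff _ (hf (i + 1))
  refine ⟨P, fun i => ModuleCat.ofHom (f (i + 1) ∘ₗ g i), hP, ?_, ?_, ?_⟩
  · intro i
    ext x
    simp only [ModuleCat.hom_ofHom, LinearMap.mem_range, LinearMap.mem_ker, LinearMap.comp_apply]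
    rw [hd, hfg]
    constructor
    · rintro ⟨y, rfl⟩
      exact ⟨_, rfl⟩
    · rintro ⟨y, rfl⟩
      obtain ⟨z, rfl⟩ := hg i y
      exact ⟨z, rfl⟩
  · intro i φ
    constructor
    · intro h
      have h0 : ∀ z, φ.hom (f (i + 1) z) = 0 := fun z => by
        obtain ⟨y, rfl⟩ := hg i z
        exact LinearMap.congr_fun (congrArg ModuleCat.Hom.hom h) y
      obtain ⟨χ, hχ⟩ := exists_comp_eq_of_surjective (g (i + 1)) (hg (i + 1)) φ.hom (fun x hx => by
        obtain ⟨z, rfl⟩ := (hfg _ x).1 hx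
        exact h0 z)
      obtain ⟨ψ, hψ⟩ := hext (i + 1 + 1) χ
      refine ⟨ModuleCat.ofHom ψ, ?_⟩
      ext x
      exact ((hψ _).trans (hχ x)).symm
    · rintro ⟨ψ, rfl⟩
      ext x
      change ψ.hom (f (i + 1 + 1) (g (i + 1) (f (i + 1) (g i x)))) = 0
      rw [(hfg _ _).2 ⟨_, rfl⟩, map_zero, map_zero]
  · have hker : LinearMap.ker (ModuleCat.ofHom (f (0 + 1) ∘ₗ g 0)).hom = LinearMap.range (f 0) := by
      ext x
      rw [LinearMap.mem_ker, LinearMap.mem_range]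
      exact (hd 0 x).trans (hfg 0 x)
    rw [hker]
    obtain rfl : (Z 0).1 = X := by rw [hZ0]
    exact ⟨LinearEquiv.ofInjective (f 0) (hf 0)⟩

end GorensteinProjective

section Products

lemma projective_pi_self (k B : Type) [Field k] [Ring B] [Algebra k B] [FiniteDimensional k B]
    (I : Type) : Module.Projective B (I → B) := by
  let e := Module.Basis.ofVectorSpace k (I → k)
  let b := Module.Basis.ofVectorSpace k B
  let L := Finsupp.linearCombination B fun s => fun i => algebraMap k B (e s i)
  have hinj : Function.Injective L := by
    rw [injective_iff_map_eq_zero]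
    intro c hc
    have key : ∀ t c, Finsupp.linearCombination k e (Finsupp.mapRange.linearMap (b.coord t) c) =
        fun i => b.coord t (L c i) := by
      intro t c
      induction c using Finsupp.induction_linear with
      | zero => ext i; simp
      | add c d hc hd => rw [map_add, map_add, hc, hd]; ext i; simp
      | single s x =>
        ext i
        simp [L, ← Algebra.commutes, ← Algebra.smul_def, mul_comm]
    ext s
    refine b.ext_elem fun t => ?_
    have h := key t c
    rw [hc] at h
    have h0 : Finsupp.mapRange.linearMap (b.coord t) c = 0 :=
      e.linearIndependent (by rw [h, map_zero]; ext i; simp)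
    simpa using DFunLike.congr_fun h0 s
  have hsurj : Function.Surjective L := by
    intro f
    have key : ∀ (v : I → k) (x : B), (fun i => v i • x) ∈ LinearMap.range L := by
      intro v x
      have h : ∀ c : _ →₀ k, L (Finsupp.mapRange.linearMap (LinearMap.toSpanSingleton k B x) c) =
          fun i => Finsupp.linearCombination k e c i • x := by
        intro c
        induction c using Finsupp.induction_linear with
        | zero => ext i; simp
        | add c d hc hd => rw [map_add, map_add, hc, hd]; ext i; simp [add_smul]
        | single s y =>
          ext i
          simp [L, ← Algebra.commutes, ← Algebra.smul_def, mul_smul, smul_comm y]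
      refine ⟨_, (h (e.repr v)).trans ?_⟩
      rw [e.linearCombination_repr]
    have hf : f = ∑ t, fun i => b.repr (f i) t • b t := by
      ext i
      rw [Finset.sum_apply]
      exact (b.sum_repr (f i)).symm
    rw [hf]
    exact Submodule.sum_mem _ fun t _ => key (fun i => b.repr (f i) t) (b t)
  have := Module.Free.of_equiv (LinearEquiv.ofBijective L ⟨hinj, hsurj⟩)
  infer_instance

lemma projective_fin_pi {B : Type} [Ring B] (X : Type) [AddCommGroup X] [Module B X]
    [Module.Projective B X] (n : ℕ) : Module.Projective B (Fin n → X) :=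
  Module.Projective.of_equiv (DFinsupp.linearEquivFunOnFintype (R := B) (M := fun _ : Fin n => X))

lemma projective_pi_of_finite {B : Type} [Ring B] (h : ∀ I : Type, Module.Projective B (I → B))
    (X : Type) [AddCommGroup X] [Module B X] [Module.Finite B X] [Module.Projective B X]
    (I : Type) : Module.Projective B (I → X) := by
  obtain ⟨n, p, hp⟩ := Module.Finite.exists_fin' B X
  obtain ⟨s, hs⟩ := Module.projective_lifting_property p LinearMap.id hp
  have := Module.Projective.of_equiv (LinearEquiv.curry B B I (Fin n))
  refine Module.Projective.of_split (M := I → Fin n → B) (s.compLeft I) (p.compLeft I) ?_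
  ext f i
  exact LinearMap.congr_fun hs (f i)

end Products

lemma HasProjInjCores.of_kernel {B : Type} [Ring B] {K P X : ModuleCat.{0} B} (f : K →ₗ[B] P)
    (g : P →ₗ[B] X) (hf : Function.Injective f) (hg : Function.Surjective g)
    (hfg : Function.Exact f g) (hP : HasProjInjCores B P) (hX : HasProjInjCores B X) :
    HasProjInjCores B K := by
  obtain ⟨Y, hY, J, a, b, hp, hi, ha, hb, hab⟩ := hP.step
  let Q := ModuleCat.of B (J ⧸ LinearMap.range (a ∘ₗ f))
  let q : J →ₗ[B] Q := (LinearMap.range (a ∘ₗ f)).mkQ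
  have hq : ∀ v, q v = 0 ↔ ∃ z, a (f z) = v := fun v =>
    (Submodule.Quotient.mk_eq_zero _).trans LinearMap.mem_range
  have hqs : Function.Surjective q := Submodule.mkQ_surjective _
  obtain ⟨u, hu⟩ := exists_comp_eq_of_surjective g hg (q ∘ₗ a) (fun x hx => by
    obtain ⟨z, rfl⟩ := (hfg x).1 hx
    exact (hq _).2 ⟨z, rfl⟩)
  obtain ⟨v, hv⟩ := exists_comp_eq_of_surjective q hqs b (fun x hx => by
    obtain ⟨z, rfl⟩ := (hq x).1 hx
    exact (hab _).2 ⟨_, rfl⟩)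
  refine .of_step ⟨J, a ∘ₗ f, q, hp, hi, ha.comp hf, hqs, hq⟩
    (.of_extension (X := X) (Z := Q) (Y := Y) u v ?_ ?_ ?_ hX hY)
  · rw [injective_iff_map_eq_zero]
    intro x hx
    obtain ⟨p, rfl⟩ := hg x
    rw [hu] at hx
    obtain ⟨z, hz⟩ := (hq _).1 hx
    exact (hfg _).2 ⟨z, ha hz⟩
  · intro y
    obtain ⟨x, rfl⟩ := hb y
    exact ⟨q x, hv x⟩
  · intro w
    obtain ⟨x, rfl⟩ := hqs w
    rw [hv, hab]
    constructor
    · rintro ⟨p, rfl⟩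
      exact ⟨g p, hu p⟩
    · rintro ⟨y, hy⟩
      obtain ⟨p, rfl⟩ := hg y
      rw [hu, LinearMap.comp_apply, ← sub_eq_zero, ← map_sub] at hy
      obtain ⟨z, hz⟩ := (hq _).1 hy
      exact ⟨p - f z, by rw [map_sub, hz]; abel⟩

/-- A coresolution `0 → B → U^m₀ → U^m₁ → ⋯` of `B`, cut into short exact sequences
`0 → C n → U^mₙ → C (n + 1) → 0`. -/
structure AddCores (B : Type) [Ring B] (U : Type) [AddCommGroup U] [Module B U] where
  C : ℕ → ModuleCat.{0} B
  m : ℕ → ℕ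
  j : ∀ n, C n →ₗ[B] (Fin (m n) → U)
  π : ∀ n, (Fin (m n) → U) →ₗ[B] C (n + 1)
  e : B ≃ₗ[B] C 0
  j_injective : ∀ n, Function.Injective (j n)
  π_surjective : ∀ n, Function.Surjective (π n)
  exact : ∀ n, Function.Exact (j n) (π n)

namespace AddCores

variable {B : Type} [Ring B] {U : Type} [AddCommGroup U] [Module B U] (𝒞 : AddCores B U)

lemma finite [Module.Finite B U] (n : ℕ) : Module.Finite B (𝒞.C n) := by
  cases n with
  | zero => exact Module.Finite.equiv 𝒞.e
  | succ n => exact Module.Finite.of_surjective (𝒞.π n) (𝒞.π_surjective n)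

lemma hasProjInjCores_pi [Module.Injective B U]
    (h : ∀ (m : ℕ) (I : Type), Module.Projective B (I → Fin m → U)) (I : Type) (n : ℕ) :
    HasProjInjCores B (ModuleCat.of B (I → 𝒞.C n)) := by
  refine ⟨fun Z => ∃ n, Z = ModuleCat.of B (I → 𝒞.C n), ⟨n, rfl⟩, ?_⟩
  rintro _ ⟨n, rfl⟩
  refine ⟨_, ⟨n + 1, rfl⟩, ModuleCat.of B (I → Fin (𝒞.m n) → U), (𝒞.j n).compLeft I,
    (𝒞.π n).compLeft I, h _ I, ?_, (𝒞.j_injective n).comp_left, (𝒞.π_surjective n).comp_left, ?_⟩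
  · change Module.Injective B (I → Fin (𝒞.m n) → U)
    infer_instance
  · intro x
    constructor
    · intro hx
      choose y hy using fun i => (𝒞.exact n (x i)).1 (congrFun hx i)
      exact ⟨y, funext hy⟩
    · rintro ⟨y, rfl⟩
      exact funext fun i => (𝒞.exact n _).2 ⟨y i, rfl⟩

lemma hasProjInjCores [Module.Injective B U] [Module.Projective B U] (n : ℕ) :
    HasProjInjCores B (𝒞.C n) := by
  refine ⟨fun Z => ∃ n, Z = 𝒞.C n, ⟨n, rfl⟩, ?_⟩
  rintro _ ⟨n, rfl⟩
  refine ⟨_, ⟨n + 1, rfl⟩, ModuleCat.of B (Fin (𝒞.m n) → U), 𝒞.j n, 𝒞.π n, ?_, ?_,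
    𝒞.j_injective n, 𝒞.π_surjective n, 𝒞.exact n⟩
  · exact projective_fin_pi U _
  · change Module.Injective B (Fin (𝒞.m n) → U)
    infer_instance

/-- Every map from `X` to a proper cosyzygy `C (n + 1)` lifts to `U^mₙ`. -/
def Lifts (X : Type) [AddCommGroup X] [Module B X] : Prop :=
  ∀ n (φ : X →ₗ[B] 𝒞.C (n + 1)), ∃ ψ : X →ₗ[B] (Fin (𝒞.m n) → U), ∀ x, 𝒞.π n (ψ x) = φ x

variable {𝒞}

lemma Lifts.of_projective (X : Type) [AddCommGroup X] [Module B X] [Module.Projective B X] :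
    𝒞.Lifts X :=
  fun n φ => exists_lift_of_projective _ (𝒞.π_surjective n) φ

section ShortExact

variable {X P Y : Type} [AddCommGroup X] [Module B X] [AddCommGroup P] [Module B P]
  [AddCommGroup Y] [Module B Y] (f : X →ₗ[B] P) (g : P →ₗ[B] Y)

lemma exists_lift_of_cokernel (hg : Function.Surjective g) (hfg : Function.Exact f g)
    [Module.Projective B P] {n : ℕ}
    (hext : ∀ χ : X →ₗ[B] 𝒞.C n, ∃ χ' : P →ₗ[B] 𝒞.C n, ∀ x, χ' (f x) = χ x)
    (φ : Y →ₗ[B] 𝒞.C (n + 1)) :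
    ∃ ψ : Y →ₗ[B] (Fin (𝒞.m n) → U), ∀ y, 𝒞.π n (ψ y) = φ y := by
  obtain ⟨ψ, hψ⟩ := exists_lift_of_projective _ (𝒞.π_surjective n) (φ ∘ₗ g)
  obtain ⟨χ, hχ⟩ := exists_comp_eq_of_injective (𝒞.j n) (𝒞.j_injective n) (ψ ∘ₗ f) (fun x =>
    (𝒞.exact n _).1 (by
      rw [LinearMap.comp_apply, hψ, LinearMap.comp_apply, (hfg _).2 ⟨x, rfl⟩, map_zero]))
  obtain ⟨χ', hχ'⟩ := hext χ
  obtain ⟨ω, hω⟩ := exists_comp_eq_of_surjective g hg (ψ - 𝒞.j n ∘ₗ χ') (fun p hp => by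
    obtain ⟨x, rfl⟩ := (hfg p).1 hp
    simp only [LinearMap.sub_apply, LinearMap.comp_apply, hχ', hχ, sub_self])
  refine ⟨ω, fun y => ?_⟩
  obtain ⟨p, rfl⟩ := hg y
  rw [hω, LinearMap.sub_apply, map_sub, LinearMap.comp_apply, (𝒞.exact n _).2 ⟨_, rfl⟩, sub_zero,
    hψ, LinearMap.comp_apply]

variable [Module.Injective B U]

lemma Lifts.exists_extension_of_injective (hf : Function.Injective f) (hX : 𝒞.Lifts X) {n : ℕ}
    (χ : X →ₗ[B] 𝒞.C (n + 1)) : ∃ χ' : P →ₗ[B] 𝒞.C (n + 1), ∀ x, χ' (f x) = χ x := by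
  obtain ⟨ρ, hρ⟩ := hX n χ
  obtain ⟨ρ', hρ'⟩ := _root_.exists_extension_of_injective f hf ρ
  exact ⟨𝒞.π n ∘ₗ ρ', fun x => by rw [LinearMap.comp_apply, hρ', hρ]⟩

lemma Lifts.of_cokernel (hf : Function.Injective f) (hg : Function.Surjective g)
    (hfg : Function.Exact f g) [Module.Projective B P] (hX : 𝒞.Lifts X)
    (hext : ∀ χ : X →ₗ[B] B, ∃ χ' : P →ₗ[B] B, ∀ x, χ' (f x) = χ x) : 𝒞.Lifts Y := by
  intro n φ
  refine exists_lift_of_cokernel f g hg hfg (fun χ => ?_) φ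
  cases n with
  | zero =>
    obtain ⟨χ', hχ'⟩ := hext (𝒞.e.symm.toLinearMap ∘ₗ χ)
    exact ⟨𝒞.e.toLinearMap ∘ₗ χ', fun x => by simp [hχ']⟩
  | succ n => exact hX.exists_extension_of_injective f hf χ

lemma Lifts.exists_extension (hf : Function.Injective f) (hg : Function.Surjective g)
    (hfg : Function.Exact f g) (hY : 𝒞.Lifts Y) {n : ℕ} (φ : X →ₗ[B] 𝒞.C n) :
    ∃ ρ : P →ₗ[B] 𝒞.C n, ∀ x, ρ (f x) = φ x := by
  obtain ⟨σ, hσ⟩ := _root_.exists_extension_of_injective f hf (𝒞.j n ∘ₗ φ)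
  obtain ⟨τ, hτ⟩ := exists_comp_eq_of_surjective g hg (𝒞.π n ∘ₗ σ) (fun p hp => by
    obtain ⟨x, rfl⟩ := (hfg p).1 hp
    rw [LinearMap.comp_apply, hσ]
    exact (𝒞.exact n _).2 ⟨_, rfl⟩)
  obtain ⟨τ', hτ'⟩ := hY n τ
  obtain ⟨ρ, hρ⟩ := exists_comp_eq_of_injective (𝒞.j n) (𝒞.j_injective n) (σ - τ' ∘ₗ g)
    (fun p => (𝒞.exact n _).1 (by
      rw [LinearMap.sub_apply, map_sub, LinearMap.comp_apply, hτ', hτ, LinearMap.comp_apply,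
        sub_self]))
  refine ⟨ρ, fun x => 𝒞.j_injective n ?_⟩
  rw [hρ, LinearMap.sub_apply, LinearMap.comp_apply, (hfg _).2 ⟨x, rfl⟩, map_zero, sub_zero, hσ,
    LinearMap.comp_apply]

lemma Lifts.of_kernel (hf : Function.Injective f) (hg : Function.Surjective g)
    (hfg : Function.Exact f g) [Module.Projective B P] (hY : 𝒞.Lifts Y) : 𝒞.Lifts X := by
  intro n φ
  obtain ⟨ρ, hρ⟩ := hY.exists_extension f g hf hg hfg φ
  obtain ⟨ψ, hψ⟩ := Lifts.of_projective P n ρ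
  exact ⟨ψ ∘ₗ f, fun x => by rw [LinearMap.comp_apply, hψ, hρ]⟩

end ShortExact

section

variable [Module.Injective B U]

lemma exists_gorStep_right (hB : ∀ I : Type, Module.Projective B (I → B))
    (hU : ∀ (m : ℕ) (I : Type), Module.Projective B (I → Fin m → U)) (X : ModuleCat.{0} B)
    (h : HasProjInjCores B X) (hX : 𝒞.Lifts X) :
    ∃ Y, (HasProjInjCores B Y ∧ 𝒞.Lifts Y) ∧ GorStep B X Y := by
  obtain ⟨Y, hY, J, a, b, hJ, hi, ha, hb, hab⟩ := h.step
  have := hB (X →ₗ[B] B)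
  let f : X →ₗ[B] (J × ((X →ₗ[B] B) → B)) := a.prod (LinearMap.pi fun φ => φ)
  have hf : Function.Injective f := fun x y hxy => ha (congrArg Prod.fst hxy)
  let Q := ModuleCat.of B ((J × ((X →ₗ[B] B) → B)) ⧸ LinearMap.range f)
  let q : (J × ((X →ₗ[B] B) → B)) →ₗ[B] Q := (LinearMap.range f).mkQ
  have hq : Function.Exact f q := fun v =>
    (Submodule.Quotient.mk_eq_zero _).trans LinearMap.mem_range
  have hqs : Function.Surjective q := Submodule.mkQ_surjective _
  have hext : ∀ φ : X →ₗ[B] B, ∃ ψ : (J × ((X →ₗ[B] B) → B)) →ₗ[B] B, ∀ x, ψ (f x) = φ x :=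
    fun φ => ⟨LinearMap.proj φ ∘ₗ LinearMap.snd B _ _, fun x => rfl⟩
  obtain ⟨v, hv⟩ := exists_comp_eq_of_surjective q hqs (b ∘ₗ LinearMap.fst B _ _) (fun w hw => by
    obtain ⟨x, rfl⟩ := (hq w).1 hw
    exact (hab _).2 ⟨x, rfl⟩)
  refine ⟨Q, ⟨?_, Lifts.of_cokernel f q hf hqs hq hX hext⟩,
    ModuleCat.of B (J × ((X →ₗ[B] B) → B)), f, q, ?_, hf, hqs, hq, hext⟩
  · have hpi : HasProjInjCores B (ModuleCat.of B ((X →ₗ[B] B) → B)) :=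
      (𝒞.hasProjInjCores_pi hU (X →ₗ[B] B) 0).of_equiv
        (X := ModuleCat.of B ((X →ₗ[B] B) → 𝒞.C 0)) (X' := ModuleCat.of B ((X →ₗ[B] B) → B))
        (LinearEquiv.piCongrRight fun _ => 𝒞.e.symm)
    refine .of_extension (X := ModuleCat.of B ((X →ₗ[B] B) → B)) (Z := Q) (Y := Y)
      (q ∘ₗ LinearMap.inr B _ _) v ?_ ?_ ?_ hpi hY
    · rw [injective_iff_map_eq_zero]
      intro w hw
      obtain ⟨x, hx⟩ := (hq _).1 hw
      have h1 : a x = 0 := congrArg Prod.fst hx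
      have h2 := congrArg Prod.snd hx
      rw [ha (h1.trans (map_zero a).symm), map_zero] at h2
      exact h2.symm
    · intro y
      obtain ⟨x, rfl⟩ := hb y
      exact ⟨q (x, 0), hv _⟩
    · intro w
      obtain ⟨⟨x, t⟩, rfl⟩ := hqs w
      rw [hv, LinearMap.comp_apply, LinearMap.fst_apply, hab]
      constructor
      · rintro ⟨z, rfl⟩
        refine ⟨t - (f z).2, ?_⟩
        rw [LinearMap.comp_apply, ← sub_eq_zero, ← map_sub]
        refine (hq _).2 ⟨-z, ?_⟩
        rw [map_neg]
        refine Prod.ext ?_ ?_ <;> simp [f]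
      · rintro ⟨t', ht'⟩
        rw [LinearMap.comp_apply, ← sub_eq_zero, ← map_sub] at ht'
        obtain ⟨z, hz⟩ := (hq _).1 ht'
        have h1 : a z = 0 - x := congrArg Prod.fst hz
        exact ⟨-z, by rw [map_neg, h1, zero_sub, neg_neg]⟩
  · change Module.Projective B (J × ((X →ₗ[B] B) → B))
    infer_instance

lemma exists_gorStep_left [IsNoetherianRing B] [Module.Projective B U] (Y : ModuleCat.{0} B)
    (h : HasProjInjCores B Y) (hY : 𝒞.Lifts Y) :
    ∃ X, (HasProjInjCores B X ∧ 𝒞.Lifts X) ∧ GorStep B X Y := by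
  classical
  have hB : HasProjInjCores B (ModuleCat.of B B) :=
    (𝒞.hasProjInjCores 0).of_equiv (X' := ModuleCat.of B B) 𝒞.e.symm
  let g : (Π₀ _ : Y, B) →ₗ[B] Y := DFinsupp.lsum ℕ fun y => LinearMap.toSpanSingleton B Y y
  have hg : Function.Surjective g := fun y => ⟨DFinsupp.single y 1, by simp [g]⟩
  let f : LinearMap.ker g →ₗ[B] (Π₀ _ : Y, B) := (LinearMap.ker g).subtype
  have hf : Function.Injective f := Subtype.val_injective
  have hfg : Function.Exact f g := LinearMap.exact_subtype_ker_map g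
  refine ⟨ModuleCat.of B (LinearMap.ker g), ⟨?_, Lifts.of_kernel f g hf hg hfg hY⟩,
    ModuleCat.of B (Π₀ _ : Y, B), f, g, ?_, hf, hg, hfg, ?_⟩
  · exact .of_kernel (K := ModuleCat.of B (LinearMap.ker g)) (P := ModuleCat.of B (Π₀ _ : Y, B))
      (X := Y) f g hf hg hfg (.dfinsupp (fun _ => ModuleCat.of B B) fun _ => hB) h
  · change Module.Projective B (Π₀ _ : Y, B)
    infer_instance
  · intro φ
    obtain ⟨ρ, hρ⟩ := hY.exists_extension f g hf hg hfg (𝒞.e.toLinearMap ∘ₗ φ)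
    exact ⟨𝒞.e.symm.toLinearMap ∘ₗ ρ, fun x => (congrArg 𝒞.e.symm (hρ x)).trans (by simp)⟩

theorem isGProj [IsNoetherianRing B] [Module.Projective B U]
    (hB : ∀ I : Type, Module.Projective B (I → B))
    (hU : ∀ (m : ℕ) (I : Type), Module.Projective B (I → Fin m → U)) {X : ModuleCat.{0} B}
    (h : HasProjInjCores B X) (hX : 𝒞.Lifts X) : IsGProj B X :=
  isGProj_of_gorStep (fun X => HasProjInjCores B X ∧ 𝒞.Lifts X)
    (fun X hX => exists_gorStep_right hB hU X hX.1 hX.2)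
    (fun Y hY => exists_gorStep_left Y hY.1 hY.2) ⟨h, hX⟩

end

end AddCores

section ExistsAddCores

variable {B : Type} [Ring B]

lemma InfiniteDomDim.hasProjInjCores (h : InfiniteDomDim B) :
    HasProjInjCores B (ModuleCat.of B B) := by
  obtain ⟨I, d0, d, hI, hd0, hd0', hd⟩ := h
  refine ⟨fun Z => ∃ n, Nonempty (Z ≃ₗ[B] LinearMap.ker (d n).hom), ⟨0, ?_⟩, ?_⟩
  · rw [← hd0']
    exact ⟨LinearEquiv.ofInjective d0.hom hd0⟩
  · rintro Z ⟨n, ⟨e⟩⟩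
    have hmem : ∀ x, (d n).hom x ∈ LinearMap.ker (d (n + 1)).hom := fun x => by
      rw [← hd n]
      exact ⟨x, rfl⟩
    refine ⟨ModuleCat.of B (LinearMap.ker (d (n + 1)).hom), ⟨n + 1, ⟨LinearEquiv.refl _ _⟩⟩, I n,
      (LinearMap.ker (d n).hom).subtype ∘ₗ e.toLinearMap, (d n).hom.codRestrict _ hmem,
      (hI n).2, (hI n).1, Subtype.val_injective.comp e.injective, ?_, ?_⟩
    · rintro ⟨x, hx⟩
      rw [← hd n] at hx
      obtain ⟨y, rfl⟩ := hx
      exact ⟨y, rfl⟩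
    · intro x
      constructor
      · intro hx
        exact ⟨e.symm ⟨x, congrArg Subtype.val hx⟩, by simp⟩
      · rintro ⟨z, rfl⟩
        exact Subtype.ext (e z).2

variable (U : Type) [AddCommGroup U] [Module B U]

lemma exists_injective_to_pi_of_finite (hBU : ∃ (d : ℕ) (i : B →ₗ[B] (Fin d → U)),
    Function.Injective i) (X : Type) [AddCommGroup X] [Module B X] [Module.Finite B X]
    {J : Type} [AddCommGroup J] [Module B J] [Module.Projective B J] (f : X →ₗ[B] J)
    (hf : Function.Injective f) :
    ∃ (m : ℕ) (j : X →ₗ[B] (Fin m → U)), Function.Injective j := by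
  classical
  obtain ⟨d, i, hi⟩ := hBU
  obtain ⟨s, hs⟩ := Module.projective_def.1 (inferInstance : Module.Projective B J)
  obtain ⟨t, ht⟩ := (Module.Finite.fg_top : (⊤ : Submodule B X).FG)
  let T : Finset J := t.biUnion fun x => (s (f x)).support
  have hT : ∀ x, s (f x) ∈ Finsupp.supported B B (T : Set J) := by
    intro x
    have hle : Submodule.span B (t : Set X) ≤
        (Finsupp.supported B B (T : Set J)).comap (s ∘ₗ f) := by
      rw [Submodule.span_le]
      intro x hx
      exact (Finsupp.mem_supported B (s (f x))).2
        (Finset.coe_subset.2 (Finset.subset_biUnion_of_mem (fun x => (s (f x)).support) hx))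
    rw [ht] at hle
    exact hle trivial
  let r : X →ₗ[B] (T → B) := LinearMap.pi fun y => Finsupp.lapply y.1 ∘ₗ s ∘ₗ f
  have hr : Function.Injective r := by
    intro x y hxy
    refine hf (hs.injective ?_)
    ext z
    by_cases hz : z ∈ T
    · exact congrFun hxy ⟨z, hz⟩
    · rw [(Finsupp.mem_supported' _ _).1 (hT x) z hz, (Finsupp.mem_supported' _ _).1 (hT y) z hz]
  let e : (T → Fin d → U) ≃ₗ[B] (Fin (Fintype.card (T × Fin d)) → U) :=
    (LinearEquiv.curry B U T (Fin d)).symm ≪≫ₗ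
      LinearEquiv.funCongrLeft B U (Fintype.equivFin (T × Fin d)).symm
  exact ⟨_, e.toLinearMap ∘ₗ i.compLeft T ∘ₗ r, e.injective.comp (hi.comp_left.comp hr)⟩

theorem exists_addCores [Module.Finite B U] [Module.Projective B U] [Module.Injective B U]
    (hBU : ∃ (d : ℕ) (i : B →ₗ[B] (Fin d → U)), Function.Injective i)
    (h : HasProjInjCores B (ModuleCat.of B B)) : Nonempty (AddCores B U) := by
  have key : ∀ X : {X : ModuleCat.{0} B // Module.Finite B X ∧ HasProjInjCores B X},
      ∃ (m : ℕ) (j : X.1 →ₗ[B] (Fin m → U)), Function.Injective j := by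
    rintro ⟨X, hfin, hX⟩
    obtain ⟨Y, hY, J, f, g, hp, hi, hf, -⟩ := hX.step
    exact exists_injective_to_pi_of_finite U hBU X f hf
  choose m j hj using key
  have hcok : ∀ X, HasProjInjCores B
      (ModuleCat.of B ((Fin (m X) → U) ⧸ LinearMap.range (j X))) := by
    intro X
    have := projective_fin_pi (B := B) U (m X)
    have hp : HasProjInjCores B (ModuleCat.of B (Fin (m X) → U)) :=
      @HasProjInjCores.of_projective_injective B _ (ModuleCat.of B (Fin (m X) → U)) this
        (inferInstanceAs (Module.Injective B (Fin (m X) → U)))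
    exact .of_cokernel (X := X.1) (Y := ModuleCat.of B (Fin (m X) → U))
      (W := ModuleCat.of B ((Fin (m X) → U) ⧸ LinearMap.range (j X))) (j X)
      (LinearMap.range (j X)).mkQ (hj X) (Submodule.mkQ_surjective _)
      (LinearMap.exact_map_mkQ_range _) X.2.2 hp
  let next : {X : ModuleCat.{0} B // Module.Finite B X ∧ HasProjInjCores B X} →
      {X : ModuleCat.{0} B // Module.Finite B X ∧ HasProjInjCores B X} := fun X =>
    ⟨ModuleCat.of B ((Fin (m X) → U) ⧸ LinearMap.range (j X)),
      inferInstanceAs (Module.Finite B ((Fin (m X) → U) ⧸ LinearMap.range (j X))), hcok X⟩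
  let Z : ℕ → {X : ModuleCat.{0} B // Module.Finite B X ∧ HasProjInjCores B X} := fun n =>
    Nat.rec ⟨ModuleCat.of B B, inferInstanceAs (Module.Finite B B), h⟩ (fun _ => next) n
  exact ⟨{ C := fun n => (Z n).1
           m := fun n => m (Z n)
           j := fun n => j (Z n)
           π := fun n => (LinearMap.range (j (Z n))).mkQ
           e := LinearEquiv.refl B B
           j_injective := fun n => hj (Z n)
           π_surjective := fun n => Submodule.mkQ_surjective _
           exact := fun n => LinearMap.exact_map_mkQ_range _ }⟩

variable {U}

lemma AddCores.isLeftOrthAcyclic [Module.Projective B U] (𝒞 : AddCores B U) (n : ℕ) :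
    IsLeftOrthAcyclic B (𝒞.C n) := by
  induction n with
  | zero =>
    have : Module.Projective B (𝒞.C 0) := Module.Projective.of_equiv 𝒞.e
    exact .of_projective _
  | succ n ih =>
    refine .of_cokernel (Y := ModuleCat.of B (Fin (𝒞.m n) → U)) (𝒞.j n) (𝒞.π n)
      (𝒞.j_injective n) (𝒞.π_surjective n) (𝒞.exact n) ih ?_
    have : Module.Projective B (ModuleCat.of B (Fin (𝒞.m n) → U)) := projective_fin_pi U _
    exact .of_projective _

end ExistsAddCores

section SequentialColimit

variable {B : Type} [Ring B]

lemma exists_sequential_colimit [IsNoetherianRing B] (X : ℕ → ModuleCat.{0} B)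
    (ι : ∀ n, X n →ₗ[B] X (n + 1)) (hι : ∀ n, Function.Injective (ι n))
    (hX : ∀ n, IsLeftOrthAcyclic B (X n)) (hX' : ∀ n, HasProjInjCores B (X n)) :
    ∃ (Y : ModuleCat.{0} B) (φ : ∀ n, X n →ₗ[B] Y), (∀ n, Function.Injective (φ n)) ∧
      (∀ n x, φ (n + 1) (ι n x) = φ n x) ∧ (∀ y, ∃ n x, φ n x = y) ∧
      IsLeftOrthAcyclic B Y ∧ HasProjInjCores B Y := by
  classical
  let D := ModuleCat.of B (Π₀ n, X n)
  let single : ∀ n, X n →ₗ[B] (Π₀ n, X n) := fun n =>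
    DFinsupp.lsingle (R := B) (M := fun n => X n) n
  let δ : (Π₀ n, X n) →ₗ[B] (Π₀ n, X n) :=
    DFinsupp.lsum ℕ fun n => single n - single (n + 1) ∘ₗ ι n
  have hδs : ∀ n x, δ (single n x) = single n x - single (n + 1) (ι n x) := fun n x => by
    simp [δ, single]
  have hδ0 : ∀ y, δ y 0 = y 0 := by
    refine LinearMap.congr_fun (f := DFinsupp.lapply (R := B) (M := fun n => X n) 0 ∘ₗ δ)
      (g := DFinsupp.lapply (R := B) (M := fun n => X n) 0) (DFinsupp.lhom_ext fun n x => ?_)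
    change δ (single n x) 0 = single n x 0
    rw [hδs, DFinsupp.sub_apply]
    exact sub_eq_self.2 (DFinsupp.single_eq_of_ne (Nat.succ_ne_zero n).symm)
  have hδS : ∀ y n, δ y (n + 1) = y (n + 1) - ι n (y n) := by
    intro y i
    refine LinearMap.congr_fun (f := DFinsupp.lapply (R := B) (M := fun n => X n) (i + 1) ∘ₗ δ)
      (g := DFinsupp.lapply (R := B) (M := fun n => X n) (i + 1) -
        ι i ∘ₗ DFinsupp.lapply (R := B) (M := fun n => X n) i) (DFinsupp.lhom_ext fun n x => ?_) y
    change δ (single n x) (i + 1) = single n x (i + 1) - ι i (single n x i)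
    rw [hδs, DFinsupp.sub_apply]
    congr 1
    by_cases h : i = n
    · subst h
      have h1 : single i x i = x := DFinsupp.single_eq_same
      rw [h1]
      exact DFinsupp.single_eq_same
    · have h1 : single n x i = 0 := DFinsupp.single_eq_of_ne h
      rw [h1, map_zero]
      exact DFinsupp.single_eq_of_ne fun h' => h (Nat.succ_injective h')
  have hδ : Function.Injective δ := by
    rw [injective_iff_map_eq_zero]
    intro y hy
    ext n
    induction n with
    | zero => rw [← hδ0, hy]
    | succ n ih =>
      have := hδS y n
      rw [hy, ih] at this
      simpa using this.symm
  let Y := ModuleCat.of B ((Π₀ n, X n) ⧸ LinearMap.range δ)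
  let p : (Π₀ n, X n) →ₗ[B] Y := (LinearMap.range δ).mkQ
  have hp : Function.Surjective p := Submodule.mkQ_surjective _
  have hδp : Function.Exact δ p := LinearMap.exact_map_mkQ_range _
  have hcomp : ∀ n x, p (single (n + 1) (ι n x)) = p (single n x) := fun n x => by
    rw [eq_comm, ← sub_eq_zero, ← map_sub, ← hδs]
    exact (hδp _).2 ⟨_, rfl⟩
  refine ⟨Y, fun n => p ∘ₗ single n, fun n => ?_, hcomp, ?_, ?_, ?_⟩
  · rw [injective_iff_map_eq_zero]
    intro a ha
    obtain ⟨y, hy⟩ := (hδp _).1 ha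
    have hne : ∀ i, i ≠ n → δ y i = 0 := fun i hi => by
      rw [hy]
      exact DFinsupp.single_eq_of_ne hi
    have hlt : ∀ i, i < n → y i = 0 := by
      intro i
      induction i with
      | zero => exact fun h => by rw [← hδ0, hne 0 h.ne]
      | succ i ih =>
        intro h
        have := hδS y i
        rw [hne _ h.ne, ih (by omega)] at this
        simpa using this.symm
    have hgt : ∀ i, n ≤ i → y (i + 1) = ι i (y i) := fun i hi => by
      have := hδS y i
      rw [hne _ (by omega)] at this
      exact sub_eq_zero.1 this.symm
    have hdesc : ∀ i, y (n + i) = 0 → y n = 0 := by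
      intro i
      induction i with
      | zero => exact id
      | succ i ih =>
        intro h
        have := hgt (n + i) (by omega)
        exact ih (hι _ (by rw [← this, map_zero]; exact h))
    have hn : y n = 0 := by
      obtain ⟨N, hN⟩ := Infinite.exists_notMem_finset (y.support.image fun i => i - n)
      refine hdesc N (by_contra fun h => hN (Finset.mem_image.2 ⟨n + N, ?_, by omega⟩))
      exact DFinsupp.mem_support_iff.2 h
    have hval : δ y n = a := by
      rw [hy]
      exact DFinsupp.single_eq_same
    rw [← hval]
    cases n with
    | zero => rw [hδ0, hn]
    | succ n => rw [hδS, hn, hlt n (by omega), map_zero, sub_zero]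
  · have hmono : Monotone fun n => LinearMap.range (p ∘ₗ single n) := by
      refine monotone_nat_of_le_succ fun n => ?_
      rintro _ ⟨x, rfl⟩
      exact ⟨ι n x, hcomp n x⟩
    intro y
    obtain ⟨d, rfl⟩ := hp y
    induction d using DFinsupp.induction with
    | h0 => exact ⟨0, 0, by simp⟩
    | ha n x d _ _ ih =>
      obtain ⟨N, z, hz⟩ := ih
      have h1 : p (single n x) ∈ LinearMap.range (p ∘ₗ single (max n N)) :=
        hmono (le_max_left n N) ⟨x, rfl⟩
      have h2 : p d ∈ LinearMap.range (p ∘ₗ single (max n N)) :=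
        hmono (le_max_right n N) ⟨z, hz⟩
      obtain ⟨w, hw⟩ := add_mem h1 h2
      exact ⟨_, w, hw.trans (map_add p _ _).symm⟩
  · exact .of_cokernel (X := D) (Y := D) (W := Y) δ p hδ hp hδp (.dfinsupp X hX) (.dfinsupp X hX)
  · exact .of_cokernel (X := D) (Y := D) (W := Y) δ p hδ hp hδp (.dfinsupp X hX') (.dfinsupp X hX')

end SequentialColimit

section SmallObject

variable {B : Type} [Ring B]

lemma exists_pushout {K V W X : Type} [AddCommGroup K] [Module B K] [AddCommGroup V] [Module B V]
    [AddCommGroup W] [Module B W] [AddCommGroup X] [Module B X] (j : K →ₗ[B] V) (π : V →ₗ[B] W)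
    (f : K →ₗ[B] X) (hj : Function.Injective j) (hπ : Function.Surjective π)
    (hjπ : Function.Exact j π) :
    ∃ (Y : ModuleCat.{0} B) (ι : X →ₗ[B] Y) (v : V →ₗ[B] Y) (p : Y →ₗ[B] W),
      Function.Injective ι ∧ Function.Surjective p ∧ Function.Exact ι p ∧
      (∀ x, v (j x) = ι (f x)) ∧ ∀ x, p (v x) = π x := by
  let r : K →ₗ[B] (X × V) := f.prod (-j)
  let Y := ModuleCat.of B ((X × V) ⧸ LinearMap.range r)
  let q : (X × V) →ₗ[B] Y := (LinearMap.range r).mkQ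
  have hq : ∀ w, q w = 0 ↔ ∃ x, r x = w := LinearMap.exact_map_mkQ_range r
  have hqs : Function.Surjective q := Submodule.mkQ_surjective _
  obtain ⟨p, hp⟩ := exists_comp_eq_of_surjective q hqs (π ∘ₗ LinearMap.snd B X V) (fun w hw => by
    obtain ⟨x, rfl⟩ := (hq w).1 hw
    simpa [r] using (hjπ _).2 ⟨x, rfl⟩)
  refine ⟨Y, q ∘ₗ LinearMap.inl B X V, q ∘ₗ LinearMap.inr B X V, p, ?_, ?_, ?_, ?_, ?_⟩
  · rw [injective_iff_map_eq_zero]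
    intro x hx
    obtain ⟨z, hz⟩ := (hq _).1 hx
    have h2 : -j z = 0 := congrArg Prod.snd hz
    have h1 : f z = x := congrArg Prod.fst hz
    rw [← h1, hj ((neg_eq_zero.1 h2).trans (map_zero j).symm), map_zero]
  · intro w
    obtain ⟨x, rfl⟩ := hπ w
    exact ⟨q (0, x), hp _⟩
  · intro y
    obtain ⟨⟨x, v⟩, rfl⟩ := hqs y
    rw [hp, LinearMap.comp_apply, LinearMap.snd_apply, hjπ]
    constructor
    · rintro ⟨z, rfl⟩
      refine ⟨x + f z, ?_⟩
      rw [LinearMap.comp_apply, ← sub_eq_zero, ← map_sub]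
      exact (hq _).2 ⟨z, by simp [r]⟩
    · rintro ⟨x', hx'⟩
      rw [LinearMap.comp_apply, ← sub_eq_zero, ← map_sub] at hx'
      obtain ⟨z, hz⟩ := (hq _).1 hx'
      have h2 : -j z = 0 - v := congrArg Prod.snd hz
      exact ⟨z, by simpa using h2⟩
  · intro x
    rw [LinearMap.comp_apply, LinearMap.comp_apply, eq_comm, ← sub_eq_zero, ← map_sub]
    exact (hq _).2 ⟨x, by simp [r]⟩
  · exact fun x => hp _

lemma exists_lift_dfinsupp {S : Type} {Y Z : S → ModuleCat.{0} B} (g : ∀ s, Y s →ₗ[B] Z s)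
    (C : Type) [AddCommGroup C] [Module B C] [Module.Finite B C]
    (hg : ∀ s (φ : C →ₗ[B] Z s), ∃ ψ : C →ₗ[B] Y s, ∀ x, g s (ψ x) = φ x)
    (φ : C →ₗ[B] (Π₀ s, Z s)) :
    ∃ ψ : C →ₗ[B] (Π₀ s, Y s), ∀ x, DFinsupp.mapRange.linearMap g (ψ x) = φ x := by
  classical
  choose ψ hψ using fun s => hg s (DFinsupp.lapply (R := B) (M := fun s => Z s) s ∘ₗ φ)
  obtain ⟨t, ht⟩ := (Module.Finite.fg_top : (⊤ : Submodule B C).FG)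
  let T : Finset S := t.biUnion fun x => (φ x).support
  have hT : ∀ s ∉ T, ∀ x, φ x s = 0 := by
    intro s hs x
    have hle : Submodule.span B (t : Set C) ≤
        LinearMap.ker (DFinsupp.lapply (R := B) (M := fun s => Z s) s ∘ₗ φ) := by
      rw [Submodule.span_le]
      intro y hy
      by_contra hne
      exact hs (Finset.mem_biUnion.2 ⟨y, hy, DFinsupp.mem_support_iff.2 hne⟩)
    rw [ht] at hle
    exact hle (x := x) trivial
  refine ⟨∑ s ∈ T, DFinsupp.lsingle (R := B) (M := fun s => Y s) s ∘ₗ ψ s, fun x => ?_⟩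
  ext s
  have hval : (∑ s ∈ T, DFinsupp.lsingle (R := B) (M := fun s => Y s) s ∘ₗ ψ s) x s =
      if s ∈ T then ψ s x else 0 := by
    rw [LinearMap.sum_apply, DFinsupp.finsetSum_apply]
    split_ifs with hs
    · rw [Finset.sum_eq_single_of_mem s hs]
      · simp
      · exact fun i _ hi => DFinsupp.single_eq_of_ne hi.symm
    · exact Finset.sum_eq_zero fun i hi => DFinsupp.single_eq_of_ne fun h => hs (h ▸ hi)
  rw [DFinsupp.mapRange.linearMap_apply, DFinsupp.mapRange_apply, hval]
  split_ifs with hs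
  · exact hψ s x
  · rw [map_zero, hT s hs]

namespace AddCores

variable {U : Type} [AddCommGroup U] [Module B U] (𝒞 : AddCores B U)
  [Module.Injective B U] [Module.Projective B U]

lemma exists_lift_one (n : ℕ) (φ : 𝒞.C 1 →ₗ[B] 𝒞.C (n + 2)) :
    ∃ ψ : 𝒞.C 1 →ₗ[B] (Fin (𝒞.m (n + 1)) → U), ∀ x, 𝒞.π (n + 1) (ψ x) = φ x := by
  have := Module.Projective.of_equiv 𝒞.e
  have := projective_fin_pi (B := B) U (𝒞.m 0)
  exact exists_lift_of_cokernel (𝒞.j 0) (𝒞.π 0) (𝒞.π_surjective 0) (𝒞.exact 0)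
    (fun χ => (Lifts.of_projective _).exists_extension_of_injective _ (𝒞.j_injective 0) χ) φ

lemma exists_small_object_step [IsNoetherianRing B] [Module.Finite B U] (X : ModuleCat.{0} B)
    (hX : IsLeftOrthAcyclic B X ∧ HasProjInjCores B X) :
    ∃ (Y : ModuleCat.{0} B) (ι : X →ₗ[B] Y), Function.Injective ι ∧
      (IsLeftOrthAcyclic B Y ∧ HasProjInjCores B Y) ∧
      (∀ n (φ : 𝒞.C (n + 1) →ₗ[B] X), ∃ ψ : (Fin (𝒞.m (n + 1)) → U) →ₗ[B] Y,
        ∀ x, ψ (𝒞.j (n + 1) x) = ι (φ x)) ∧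
      ∀ (f : 𝒞.C 0 →ₗ[B] X) (g : (Fin (𝒞.m 0) → U) →ₗ[B] Y), (∀ x, g (𝒞.j 0 x) = ι (f x)) →
        ∃ h : (Fin (𝒞.m 0) → U) →ₗ[B] X, ∀ x, h (𝒞.j 0 x) = f x := by
  classical
  let S := Σ n, 𝒞.C (n + 1) →ₗ[B] X
  let K : S → ModuleCat.{0} B := fun s => 𝒞.C (s.1 + 1)
  let V : S → ModuleCat.{0} B := fun s => ModuleCat.of B (Fin (𝒞.m (s.1 + 1)) → U)
  let W : S → ModuleCat.{0} B := fun s => 𝒞.C (s.1 + 2)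
  let j : ∀ s, K s →ₗ[B] V s := fun s => 𝒞.j (s.1 + 1)
  let π : ∀ s, V s →ₗ[B] W s := fun s => 𝒞.π (s.1 + 1)
  let f : (Π₀ s, K s) →ₗ[B] X := DFinsupp.lsum ℕ fun s => (s.2 : K s →ₗ[B] X)
  obtain ⟨Y, ι, v, p, hι, hp, hιp, hv, hpv⟩ := exists_pushout (DFinsupp.mapRange.linearMap j)
    (DFinsupp.mapRange.linearMap π) f
    (dfinsupp_mapRange_injective j fun s => 𝒞.j_injective (s.1 + 1))
    (dfinsupp_mapRange_surjective π fun s => 𝒞.π_surjective (s.1 + 1))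
    (dfinsupp_mapRange_exact j π fun s => 𝒞.exact (s.1 + 1))
  refine ⟨Y, ι, hι, ⟨?_, ?_⟩, fun n φ => ?_, fun f g hfg => ?_⟩
  · exact .of_extension (W := ModuleCat.of B (Π₀ s, W s)) ι p hι hp hιp hX.1
      (.dfinsupp W fun s => 𝒞.isLeftOrthAcyclic (s.1 + 2))
  · exact .of_extension (Y := ModuleCat.of B (Π₀ s, W s)) ι p hι hp hιp hX.2
      (.dfinsupp W fun s => 𝒞.hasProjInjCores (s.1 + 2))
  · refine ⟨v ∘ₗ DFinsupp.lsingle (R := B) (M := fun s => V s) ⟨n, φ⟩, fun x => ?_⟩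
    have h := hv (DFinsupp.lsingle (R := B) (M := fun s => K s) ⟨n, φ⟩ x)
    rw [DFinsupp.mapRange.linearMap_apply, DFinsupp.lsingle_apply, DFinsupp.mapRange_single] at h
    refine h.trans (congrArg ι ?_)
    simp [f]
  · obtain ⟨τ, hτ⟩ := exists_comp_eq_of_surjective (𝒞.π 0) (𝒞.π_surjective 0) (p ∘ₗ g)
      (fun x hx => by
        obtain ⟨c, rfl⟩ := (𝒞.exact 0 x).1 hx
        rw [LinearMap.comp_apply, hfg]
        exact (hιp _).2 ⟨_, rfl⟩)
    have := 𝒞.finite 1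
    obtain ⟨τ', hτ'⟩ := exists_lift_dfinsupp π (𝒞.C 1) (fun s φ => 𝒞.exists_lift_one s.1 φ) τ
    obtain ⟨h, hh⟩ := exists_comp_eq_of_injective ι hι (g - v ∘ₗ τ' ∘ₗ 𝒞.π 0) (fun x =>
      (hιp _).1 (by
        rw [LinearMap.sub_apply, map_sub, LinearMap.comp_apply, hpv, LinearMap.comp_apply, hτ', hτ,
          LinearMap.comp_apply, sub_self]))
    refine ⟨h, fun x => hι ?_⟩
    rw [hh, LinearMap.sub_apply, LinearMap.comp_apply, LinearMap.comp_apply,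
      (𝒞.exact 0 _).2 ⟨x, rfl⟩, map_zero, map_zero, sub_zero, hfg]

theorem exists_small_object [IsNoetherianRing B] [Module.Finite B U] :
    ∃ (X : ModuleCat.{0} B) (ι : 𝒞.C 0 →ₗ[B] X), IsLeftOrthAcyclic B X ∧ HasProjInjCores B X ∧
      (∀ n (φ : 𝒞.C (n + 1) →ₗ[B] X), ∃ ψ : (Fin (𝒞.m (n + 1)) → U) →ₗ[B] X,
        ∀ x, ψ (𝒞.j (n + 1) x) = φ x) ∧
      ((∃ g : (Fin (𝒞.m 0) → U) →ₗ[B] X, ∀ x, g (𝒞.j 0 x) = ι x) →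
        ∃ r : (Fin (𝒞.m 0) → U) →ₗ[B] 𝒞.C 0, ∀ x, r (𝒞.j 0 x) = x) := by
  choose next ι hι hnext hext hdesc using fun X :
    {X : ModuleCat.{0} B // IsLeftOrthAcyclic B X ∧ HasProjInjCores B X} =>
      𝒞.exists_small_object_step X.1 X.2
  let Z : ℕ → {X : ModuleCat.{0} B // IsLeftOrthAcyclic B X ∧ HasProjInjCores B X} := fun n =>
    Nat.rec ⟨𝒞.C 0, 𝒞.isLeftOrthAcyclic 0, 𝒞.hasProjInjCores 0⟩ (fun _ X => ⟨next X, hnext X⟩) n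
  obtain ⟨X, φ, hφ, hφι, hsurj, hX, hX'⟩ := exists_sequential_colimit (fun n => (Z n).1)
    (fun n => ι (Z n)) (fun n => hι (Z n)) (fun n => (Z n).2.1) (fun n => (Z n).2.2)
  have hmono : Monotone fun n => LinearMap.range (φ n) := by
    refine monotone_nat_of_le_succ fun n => ?_
    rintro _ ⟨x, rfl⟩
    exact ⟨ι (Z n) x, hφι n x⟩
  have hfin : ∀ (C : Type) [AddCommGroup C] [Module B C] [Module.Finite B C] (g : C →ₗ[B] X),
      ∃ (n : ℕ) (u : C →ₗ[B] (Z n).1), ∀ x, φ n (u x) = g x := by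
    intro C _ _ _ g
    obtain ⟨t, ht⟩ := (Module.Finite.fg_top : (⊤ : Submodule B C).FG)
    choose N hN using fun x => hsurj (g x)
    have hle : Submodule.span B (t : Set C) ≤ (LinearMap.range (φ (t.sup N))).comap g := by
      rw [Submodule.span_le]
      exact fun x hx => hmono (Finset.le_sup hx) (hN x)
    rw [ht] at hle
    exact ⟨_, exists_comp_eq_of_injective _ (hφ _) g fun x => hle (x := x) trivial⟩
  refine ⟨X, φ 0, hX, hX', fun n f => ?_, ?_⟩
  · have := 𝒞.finite (n + 1)
    obtain ⟨N, u, hu⟩ := hfin _ f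
    obtain ⟨ψ, hψ⟩ := hext (Z N) n u
    exact ⟨φ (N + 1) ∘ₗ ψ, fun x => by
      rw [LinearMap.comp_apply, hψ, ← hu]
      exact hφι N _⟩
  · rintro ⟨g, hg⟩
    have key : ∀ N, (∃ u : (Fin (𝒞.m 0) → U) →ₗ[B] (Z N).1, ∀ x, φ N (u (𝒞.j 0 x)) = φ 0 x) →
        ∃ u : (Fin (𝒞.m 0) → U) →ₗ[B] (Z 0).1, ∀ x, φ 0 (u (𝒞.j 0 x)) = φ 0 x := by
      intro N
      induction N with
      | zero => exact id
      | succ N ih =>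
        rintro ⟨u, hu⟩
        obtain ⟨f, hf⟩ := exists_comp_eq_of_injective (φ N) (hφ N) (φ 0)
          fun x => hmono (Nat.zero_le N) ⟨x, rfl⟩
        obtain ⟨h, hh⟩ := hdesc (Z N) f u (fun x => hφ (N + 1) (by
          rw [hu]
          exact (hf x).symm.trans (hφι N _).symm))
        exact ih ⟨h, fun x => by rw [hh, hf]⟩
    obtain ⟨N, u, hu⟩ := hfin _ g
    obtain ⟨r, hr⟩ := key N ⟨u, fun x => by rw [hu, hg]⟩
    exact ⟨r, fun x => hφ 0 (hr x)⟩

end AddCores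

end SmallObject

section TraceDuality

lemma exists_dual_comp_eq {k V W : Type*} [Field k] [AddCommGroup V] [Module k V] [AddCommGroup W]
    [Module k W] (T : V →ₗ[k] W) (Φ : V →ₗ[k] k) (h : ∀ v, T v = 0 → Φ v = 0) :
    ∃ Ψ : W →ₗ[k] k, ∀ v, Ψ (T v) = Φ v := by
  have hmem : Φ ∈ LinearMap.range T.dualMap := by
    rw [LinearMap.range_dualMap_eq_dualAnnihilator_ker]
    exact (Submodule.mem_dualAnnihilator _).2 h
  obtain ⟨Ψ, rfl⟩ := hmem
  exact ⟨Ψ, fun v => rfl⟩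

/-- A symmetric trace on the endomorphism ring of `U` for which `Hom(X, U)` is the `k`-dual of
`Hom(U, X)`, for every module `X`. -/
structure TraceDuality (k B U : Type) [Field k] [Ring B] [Algebra k B] [AddCommGroup U] [Module B U]
    [Module k U] [IsScalarTower k B U] where
  tr : (U →ₗ[B] U) →ₗ[k] k
  tr_comm : ∀ a b : U →ₗ[B] U, tr (a ∘ₗ b) = tr (b ∘ₗ a)
  exists_rep : ∀ (X : Type) [AddCommGroup X] [Module B X] [Module k X] [IsScalarTower k B X]
    (Φ : (U →ₗ[B] X) →ₗ[k] k), ∃ f : X →ₗ[B] U, ∀ g, tr (f ∘ₗ g) = Φ g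
  eq_zero : ∀ (X : Type) [AddCommGroup X] [Module B X] (f : X →ₗ[B] U),
    (∀ g, tr (f ∘ₗ g) = 0) → f = 0

namespace TraceDuality

variable {k B U : Type} [Field k] [Ring B] [Algebra k B] [AddCommGroup U] [Module B U]
    [Module k U] [IsScalarTower k B U] (t : TraceDuality k B U)

/-- The trace on endomorphisms of `U^n`. -/
def trPi (n : ℕ) : ((Fin n → U) →ₗ[B] (Fin n → U)) →ₗ[k] k where
  toFun e := ∑ i, t.tr (LinearMap.proj i ∘ₗ e ∘ₗ LinearMap.single B (fun _ => U) i)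
  map_add' a b := by
    simp only [LinearMap.add_comp, LinearMap.comp_add, map_add, Finset.sum_add_distrib]
  map_smul' c a := by
    simp only [LinearMap.smul_comp, LinearMap.comp_smul, map_smul, Finset.smul_sum,
      RingHom.id_apply]

lemma trPi_apply {n : ℕ} (e : (Fin n → U) →ₗ[B] (Fin n → U)) : t.trPi n e =
    ∑ i, t.tr (LinearMap.proj i ∘ₗ e ∘ₗ LinearMap.single B (fun _ => U) i) :=
  rfl

lemma trPi_comm {m n : ℕ} (a : (Fin m → U) →ₗ[B] (Fin n → U)) (b : (Fin n → U) →ₗ[B] (Fin m → U)) :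
    t.trPi n (a ∘ₗ b) = t.trPi m (b ∘ₗ a) := by
  have key : ∀ {m n : ℕ} (a : (Fin m → U) →ₗ[B] (Fin n → U)) (b : (Fin n → U) →ₗ[B] (Fin m → U)),
      t.trPi n (a ∘ₗ b) = ∑ i, ∑ l,
        t.tr ((LinearMap.proj i ∘ₗ a ∘ₗ LinearMap.single B (fun _ => U) l) ∘ₗ
          (LinearMap.proj l ∘ₗ b ∘ₗ LinearMap.single B (fun _ => U) i)) := by
    intro m n a b
    rw [trPi_apply]
    refine Finset.sum_congr rfl fun i _ => ?_
    rw [← map_sum]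
    congr 1
    ext x
    have hb : b (Pi.single i x) = ∑ l, Pi.single l (b (Pi.single i x) l) :=
      (Finset.univ_sum_single _).symm
    simp only [LinearMap.comp_apply, LinearMap.coe_single, LinearMap.sum_apply]
    rw [hb, map_sum, map_sum]
    simp only [LinearMap.coe_proj, Function.eval, Finset.univ_sum_single]
  rw [key, key, Finset.sum_comm]
  exact Finset.sum_congr rfl fun i _ => Finset.sum_congr rfl fun l _ => t.tr_comm _ _

lemma exists_rep_pi (n : ℕ) (X : Type) [AddCommGroup X] [Module B X] [Module k X]
    [IsScalarTower k B X] (Φ : ((Fin n → U) →ₗ[B] X) →ₗ[k] k) :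
    ∃ f : X →ₗ[B] (Fin n → U), ∀ g, t.trPi n (f ∘ₗ g) = Φ g := by
  choose f hf using fun i : Fin n => t.exists_rep X
    { toFun := fun h => Φ (h ∘ₗ LinearMap.proj i)
      map_add' := fun a b => by rw [LinearMap.add_comp, map_add]
      map_smul' := fun c a => by rw [LinearMap.smul_comp, map_smul, RingHom.id_apply] }
  refine ⟨LinearMap.pi f, fun g => ?_⟩
  have hg : g = ∑ i, (g ∘ₗ LinearMap.single B (fun _ => U) i) ∘ₗ LinearMap.proj i := by
    refine LinearMap.ext fun x => ?_
    conv_lhs => rw [← Finset.univ_sum_single x]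
    simp
  conv_rhs => rw [hg, map_sum]
  rw [trPi_apply]
  exact Finset.sum_congr rfl fun i _ => hf i (g ∘ₗ LinearMap.single B (fun _ => U) i)

lemma eq_zero_pi {n : ℕ} {X : Type} [AddCommGroup X] [Module B X] (f : X →ₗ[B] (Fin n → U))
    (h : ∀ g, t.trPi n (f ∘ₗ g) = 0) : f = 0 := by
  have hi : ∀ i, LinearMap.proj i ∘ₗ f = 0 := by
    refine fun i => t.eq_zero X _ fun g => ?_
    rw [← h (g ∘ₗ LinearMap.proj i), trPi_apply, Finset.sum_eq_single_of_mem i (Finset.mem_univ i)]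
    · congr 1
      ext x
      simp
    · intro l _ hl
      rw [show LinearMap.proj l ∘ₗ (f ∘ₗ g ∘ₗ LinearMap.proj i) ∘ₗ
        LinearMap.single B (fun _ => U) l = 0 from ?_, map_zero]
      ext x
      simp [Pi.single_eq_of_ne hl.symm]
  ext x i
  exact LinearMap.congr_fun (hi i) x

lemma eq_of_trPi_eq {n : ℕ} {X : Type} [AddCommGroup X] [Module B X] (f f' : X →ₗ[B] (Fin n → U))
    (h : ∀ g, t.trPi n (f ∘ₗ g) = t.trPi n (f' ∘ₗ g)) : f = f' :=
  sub_eq_zero.1 (t.eq_zero_pi _ fun g => by rw [LinearMap.sub_comp, map_sub, h, sub_self])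

/-- If `B` is a direct summand of some `U^n`, then `B` is symmetric. -/
theorem isSymmetricAlg_of_retract (t : TraceDuality k B U) {n : ℕ} (j : B →ₗ[B] (Fin n → U))
    (r : (Fin n → U) →ₗ[B] B)
    (hr : ∀ x, r (j x) = x) : IsSymmetricAlg k B := by
  let R : B → B →ₗ[B] B := fun b => LinearMap.toSpanSingleton B B b
  have hR : ∀ b c, R c ∘ₗ R b = R (b * c) := fun b c => by ext; simp [R]
  let T : B →ₗ[k] k :=
    { toFun := fun b => t.trPi n (j ∘ₗ R b ∘ₗ r)
      map_add' := fun b c => by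
        rw [← map_add]
        congr 1
        ext
        simp [R, mul_add]
      map_smul' := fun c b => by
        rw [← map_smul]
        congr 1
        refine LinearMap.ext fun x => ?_
        simp only [R, LinearMap.comp_apply, LinearMap.toSpanSingleton_apply, smul_eq_mul,
          LinearMap.smul_apply, RingHom.id_apply, mul_smul_comm]
        exact j.map_smul_of_tower c _ }
  have hT : ∀ b, T b = t.trPi n (j ∘ₗ R b ∘ₗ r) := fun b => rfl
  have hrj : ∀ f : (Fin n → U) →ₗ[B] B, r ∘ₗ j ∘ₗ f = f := fun f => by
    ext x
    exact hr _
  have hcomm : ∀ b c, T (b * c) = T (c * b) := by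
    intro b c
    have key : ∀ b c, T (b * c) = t.trPi n ((j ∘ₗ R c ∘ₗ r) ∘ₗ (j ∘ₗ R b ∘ₗ r)) := by
      intro b c
      rw [hT, ← hR]
      congr 1
      ext x
      simp [hr]
    rw [key, key, t.trPi_comm]
  refine ⟨LinearMap.mk₂ k (fun b c => T (b * c)) (fun a b c => by rw [add_mul, map_add])
    (fun a b c => by rw [smul_mul_assoc, map_smul]) (fun a b c => by rw [mul_add, map_add])
    (fun a b c => by rw [mul_smul_comm, map_smul]), hcomm, fun x y z => ?_, fun b hb => ?_⟩
  · simp [mul_assoc]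
  · have hj : j ∘ₗ R b = 0 := by
      refine t.eq_zero_pi _ fun g => ?_
      have h1 : (j ∘ₗ R b) ∘ₗ g = (j ∘ₗ r) ∘ₗ ((j ∘ₗ R b) ∘ₗ g) := by
        ext x
        simp [hr]
      have h2 : ((j ∘ₗ R b) ∘ₗ g) ∘ₗ (j ∘ₗ r) = j ∘ₗ R (g (j 1) * b) ∘ₗ r := by
        have h3 : g ∘ₗ j = R (g (j 1)) := by
          ext
          simp [R]
        rw [← hR, ← h3]
        rfl
      rw [h1, t.trPi_comm, h2, ← hT, hcomm]
      exact hb _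
    have h0 : j b = 0 := by simpa [R] using LinearMap.congr_fun hj 1
    rw [← hr b, h0, map_zero]

end TraceDuality

end TraceDuality

namespace AddCores

variable {k B U : Type} [Field k] [Ring B] [Algebra k B] [AddCommGroup U] [Module B U]
  [Module k U] [IsScalarTower k B U] {𝒞 : AddCores B U}

/-- Every map from a proper cosyzygy `C (n + 1)` to `X` extends to `U^mₙ₊₁`. -/
def Extends (𝒞 : AddCores B U) (X : Type) [AddCommGroup X] [Module B X] : Prop :=
  ∀ n (φ : 𝒞.C (n + 1) →ₗ[B] X), ∃ ψ : (Fin (𝒞.m (n + 1)) → U) →ₗ[B] X,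
    ∀ x, ψ (𝒞.j (n + 1) x) = φ x

variable {X : Type} [AddCommGroup X] [Module B X]

lemma Extends.trPi_eq_zero (t : TraceDuality k B U) (hX : 𝒞.Extends X) {n : ℕ}
    (φ : X →ₗ[B] 𝒞.C n) (h : (Fin (𝒞.m n) → U) →ₗ[B] X) (hh : ∀ x, h (𝒞.j n x) = 0) :
    t.trPi (𝒞.m n) ((𝒞.j n ∘ₗ φ) ∘ₗ h) = 0 := by
  obtain ⟨u, hu⟩ := exists_comp_eq_of_surjective (𝒞.π n) (𝒞.π_surjective n) h (fun x hx => by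
    obtain ⟨c, rfl⟩ := (𝒞.exact n x).1 hx
    exact hh c)
  obtain ⟨v, hv⟩ := hX n u
  have h1 : (𝒞.j n ∘ₗ φ) ∘ₗ h = ((𝒞.j n ∘ₗ φ) ∘ₗ v) ∘ₗ (𝒞.j (n + 1) ∘ₗ 𝒞.π n) := by
    refine LinearMap.ext fun x => ?_
    simp only [LinearMap.comp_apply, hv, hu]
  have h2 : (𝒞.j (n + 1) ∘ₗ 𝒞.π n) ∘ₗ ((𝒞.j n ∘ₗ φ) ∘ₗ v) = 0 := by
    refine LinearMap.ext fun x => ?_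
    simp only [LinearMap.comp_apply, (𝒞.exact n _).2 ⟨_, rfl⟩, map_zero, LinearMap.zero_apply]
  rw [h1, t.trPi_comm, h2, map_zero]

variable [Module k X] [IsScalarTower k B X]

lemma Extends.lifts (t : TraceDuality k B U) (hX : 𝒞.Extends X) : 𝒞.Lifts X := by
  intro n φ
  let d : (Fin (𝒞.m n) → U) →ₗ[B] (Fin (𝒞.m (n + 1)) → U) := 𝒞.j (n + 1) ∘ₗ 𝒞.π n
  let T : ((Fin (𝒞.m (n + 1)) → U) →ₗ[B] X) →ₗ[k] ((Fin (𝒞.m n) → U) →ₗ[B] X) :=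
    { toFun := fun h => h ∘ₗ d
      map_add' := fun a b => LinearMap.add_comp _ _ _
      map_smul' := fun c a => LinearMap.smul_comp _ _ _ }
  let Φ : ((Fin (𝒞.m (n + 1)) → U) →ₗ[B] X) →ₗ[k] k :=
    { toFun := fun h => t.trPi _ ((𝒞.j (n + 1) ∘ₗ φ) ∘ₗ h)
      map_add' := fun a b => by rw [LinearMap.comp_add, map_add]
      map_smul' := fun c a => by
        rw [← map_smul]
        congr 1
        exact LinearMap.ext fun x => (𝒞.j (n + 1) ∘ₗ φ).map_smul_of_tower c (a x) }
  obtain ⟨Ψ, hΨ⟩ := exists_dual_comp_eq T Φ (fun h hh => by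
    refine hX.trPi_eq_zero t φ h fun x => ?_
    obtain ⟨y, rfl⟩ := 𝒞.π_surjective n x
    exact LinearMap.congr_fun hh y)
  obtain ⟨G, hG⟩ := t.exists_rep_pi _ X Ψ
  have key : d ∘ₗ G = 𝒞.j (n + 1) ∘ₗ φ := by
    refine t.eq_of_trPi_eq _ _ fun h => ?_
    have h1 := (hG (h ∘ₗ d)).trans (hΨ h)
    rw [LinearMap.comp_assoc, t.trPi_comm]
    exact h1
  exact ⟨G, fun x => 𝒞.j_injective (n + 1) (LinearMap.congr_fun key x)⟩

lemma Extends.exists_factorization (t : TraceDuality k B U) (hX : 𝒞.Extends X) {r : ℕ}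
    (p : (Fin r → U) →ₗ[B] B) (hp : ∀ x : X, (∀ u, p u • x = 0) → x = 0) (f : X →ₗ[B] B) :
    ∃ G : X →ₗ[B] (Fin r → U), ∀ x, p (G x) = f x := by
  let j : B →ₗ[B] (Fin (𝒞.m 0) → U) := 𝒞.j 0 ∘ₗ 𝒞.e.toLinearMap
  have hj : Function.Injective j := (𝒞.j_injective 0).comp 𝒞.e.injective
  let Φ : ((Fin (𝒞.m 0) → U) →ₗ[B] X) →ₗ[k] k :=
    { toFun := fun h => t.trPi _ ((j ∘ₗ f) ∘ₗ h)
      map_add' := fun a b => by rw [LinearMap.comp_add, map_add]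
      map_smul' := fun c a => by
        rw [← map_smul]
        congr 1
        exact LinearMap.ext fun x => (j ∘ₗ f).map_smul_of_tower c (a x) }
  let T : ((Fin (𝒞.m 0) → U) →ₗ[B] X) →ₗ[k] X :=
    { toFun := fun h => h (j 1)
      map_add' := fun a b => rfl
      map_smul' := fun c a => rfl }
  obtain ⟨Ψ, hΨ⟩ := exists_dual_comp_eq T Φ (fun h hh => by
    refine hX.trPi_eq_zero t (𝒞.e.toLinearMap ∘ₗ f) h fun x => ?_
    obtain ⟨b, rfl⟩ := 𝒞.e.surjective x
    have hb : h (j b) = b • h (j 1) := by rw [← map_smul, ← map_smul, smul_eq_mul, mul_one]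
    exact hb.trans (by rw [show h (j 1) = 0 from hh, smul_zero]))
  let S : X →ₗ[k] ((Fin r → U) →ₗ[B] X) :=
    { toFun := fun x => LinearMap.toSpanSingleton B X x ∘ₗ p
      map_add' := fun a b => by ext; simp
      map_smul' := fun c a => LinearMap.ext fun x => by
        simp [smul_comm c] }
  obtain ⟨Θ, hΘ⟩ := exists_dual_comp_eq S Ψ (fun x hx => by
    rw [hp x fun u => LinearMap.congr_fun hx u, map_zero])
  obtain ⟨G, hG⟩ := t.exists_rep_pi r X Θ
  have key : (j ∘ₗ p) ∘ₗ G = j ∘ₗ f := by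
    refine t.eq_of_trPi_eq _ _ fun h => ?_
    have h1 := (hG (S (T h))).trans ((hΘ (T h)).trans (hΨ h))
    have h2 : S (T h) = h ∘ₗ j ∘ₗ p := LinearMap.ext fun u => by
      change p u • h (j 1) = h (j (p u))
      rw [← map_smul, ← map_smul, smul_eq_mul, mul_one]
    rw [LinearMap.comp_assoc, t.trPi_comm, LinearMap.comp_assoc, ← h2]
    exact h1
  exact ⟨G, fun x => hj (LinearMap.congr_fun key x)⟩

end AddCores

/-- A virtually Gorenstein algebra with infinite dominant dimension is symmetric as soon as it has
a faithful projective-injective module with a trace duality. -/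
theorem isSymmetricAlg_of_traceDuality {k B U : Type} [Field k] [Ring B] [Algebra k B]
    [FiniteDimensional k B] [AddCommGroup U] [Module B U] [Module k U] [IsScalarTower k B U]
    [Module.Finite B U] [Module.Projective B U] [Module.Injective B U] (t : TraceDuality k B U)
    (hBU : ∃ (d : ℕ) (i : B →ₗ[B] (Fin d → U)), Function.Injective i)
    {r : ℕ} (p : (Fin r → U) →ₗ[B] B) (hp : ∀ b : B, (∀ u, p u * b = 0) → b = 0)
    (hvg : VirtGorenstein B) (hdom : InfiniteDomDim B) : IsSymmetricAlg k B := by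
  have : IsNoetherianRing B := isNoetherian_of_tower k inferInstance
  obtain ⟨𝒞⟩ := exists_addCores U hBU hdom.hasProjInjCores
  obtain ⟨X, ι, hX, hX', hext, hret⟩ := 𝒞.exists_small_object
  let _ : Module k X := Module.compHom X (algebraMap k B)
  have : IsScalarTower k B X := ⟨fun c b x => by
    rw [Algebra.smul_def, mul_smul]
    rfl⟩
  have hX'' : 𝒞.Extends X := hext
  obtain ⟨Y, hY, J, a, b, hJp, hJi, ha, hb, hab⟩ := hX'.step
  have hpX : ∀ x : X, (∀ u, p u • x = 0) → x = 0 := by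
    intro x hx
    obtain ⟨s, hs⟩ := Module.projective_def.1 hJp
    refine ha (hs.injective ?_)
    rw [map_zero, map_zero]
    ext z
    refine hp _ fun u => ?_
    rw [← smul_eq_mul, ← Finsupp.smul_apply, ← map_smul, ← map_smul, hx, map_zero, map_zero,
      Finsupp.zero_apply]
  have hYlift : 𝒞.Lifts Y := by
    refine AddCores.Lifts.of_cokernel a b ha hb hab (hX''.lifts t) fun χ => ?_
    obtain ⟨G, hG⟩ := hX''.exists_factorization t p hpX χ
    obtain ⟨G', hG'⟩ := exists_extension_of_injective a ha G
    exact ⟨p ∘ₗ G', fun x => by rw [LinearMap.comp_apply, hG', hG]⟩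
  have hGor : IsGProj B Y := AddCores.isGProj (projective_pi_self k B)
    (fun m I => by
      have := projective_fin_pi (B := B) U m
      exact projective_pi_of_finite (projective_pi_self k B) (Fin m → U) I) hY hYlift
  obtain ⟨u, hu⟩ := exists_extension_of_extZero' B (hX.extZero'_of_isGProj hvg hGor) a b ha hb hab
    LinearMap.id
  obtain ⟨v, hv⟩ := exists_extension_of_injective (𝒞.j 0) (𝒞.j_injective 0) (a ∘ₗ ι)
  obtain ⟨q, hq⟩ := hret ⟨u ∘ₗ v, fun x => by
    rw [LinearMap.comp_apply, hv, LinearMap.comp_apply, hu, LinearMap.id_apply]⟩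
  exact t.isSymmetricAlg_of_retract (𝒞.j 0 ∘ₗ 𝒞.e.toLinearMap) (𝒞.e.symm.toLinearMap ∘ₗ q)
    fun x => by simp [hq]

/-- A module with a trace duality is injective. -/
theorem TraceDuality.injective {k B U : Type} [Field k] [Ring B] [Algebra k B] [AddCommGroup U]
    [Module B U] [Module k U] [IsScalarTower k B U] (t : TraceDuality k B U) :
    Module.Injective B U := by
  refine ⟨fun X Y _ _ _ _ i hi f => ?_⟩
  let _ : Module k X := Module.compHom X (algebraMap k B)
  let _ : Module k Y := Module.compHom Y (algebraMap k B)
  have : IsScalarTower k B X := ⟨fun c b x => by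
    rw [Algebra.smul_def, mul_smul]
    rfl⟩
  have : IsScalarTower k B Y := ⟨fun c b x => by
    rw [Algebra.smul_def, mul_smul]
    rfl⟩
  let Φ : (U →ₗ[B] X) →ₗ[k] k :=
    { toFun := fun h => t.tr (f ∘ₗ h)
      map_add' := fun a b => by rw [LinearMap.comp_add, map_add]
      map_smul' := fun c a => by
        rw [← map_smul]
        congr 1
        exact LinearMap.ext fun x => f.map_smul_of_tower c (a x) }
  let T : (U →ₗ[B] X) →ₗ[k] (U →ₗ[B] Y) :=
    { toFun := fun h => i ∘ₗ h
      map_add' := fun a b => LinearMap.comp_add _ _ _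
      map_smul' := fun c a => LinearMap.ext fun x => i.map_smul_of_tower c (a x) }
  obtain ⟨Ψ, hΨ⟩ := exists_dual_comp_eq T Φ fun h hh => by
    have h0 : h = 0 := LinearMap.ext fun x => hi <| by
      rw [LinearMap.zero_apply, map_zero]
      exact LinearMap.congr_fun hh x
    rw [h0, map_zero]
  obtain ⟨G, hG⟩ := t.exists_rep Y Ψ
  have key : G ∘ₗ i - f = 0 := t.eq_zero X _ fun g => by
    rw [LinearMap.sub_comp, map_sub, LinearMap.comp_assoc, sub_eq_zero]
    exact (hG (T g)).trans (hΨ g)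
  exact ⟨G, fun x => LinearMap.congr_fun (sub_eq_zero.1 key) x⟩

/-- The `A`-dual of `M`, as a left module over the opposite endomorphism ring of `M`. -/
def HomDual (A M : Type) [Ring A] [AddCommGroup M] [Module A M] : Type := M →ₗ[A] A

namespace HomDual

section Basic

variable {A M : Type} [Ring A] [AddCommGroup M] [Module A M]

noncomputable instance : AddCommGroup (HomDual A M) := inferInstanceAs (AddCommGroup (M →ₗ[A] A))

instance : FunLike (HomDual A M) M A := inferInstanceAs (FunLike (M →ₗ[A] A) M A)

instance : LinearMapClass (HomDual A M) A M A :=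
  inferInstanceAs (LinearMapClass (M →ₗ[A] A) A M A)

@[ext]
lemma ext {u v : HomDual A M} (h : ∀ m, u m = v m) : u = v := LinearMap.ext h

@[simp]
lemma add_apply (u v : HomDual A M) (m : M) : (u + v) m = u m + v m := rfl

@[simp]
lemma zero_apply (m : M) : (0 : HomDual A M) m = 0 := rfl

/-- Evaluation at `m` as an additive map. -/
def evalHom (m : M) : HomDual A M →+ A where
  toFun u := u m
  map_zero' := rfl
  map_add' _ _ := rfl

lemma sum_apply {ι : Type*} (s : Finset ι) (u : ι → HomDual A M) (m : M) :
    (∑ i ∈ s, u i) m = ∑ i ∈ s, u i m :=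
  map_sum (evalHom m) u s

noncomputable instance : Module (Module.End A M)ᵐᵒᵖ (HomDual A M) where
  smul b u := LinearMap.comp (M₂ := M) u b.unop
  one_smul _ := rfl
  mul_smul _ _ _ := rfl
  smul_zero _ := rfl
  smul_add _ _ _ := rfl
  add_smul b c u := ext fun m => map_add u (b.unop m) (c.unop m)
  zero_smul u := ext fun _ => map_zero u

@[simp]
lemma smul_apply (b : (Module.End A M)ᵐᵒᵖ) (u : HomDual A M) (m : M) : (b • u) m = u (b.unop m) :=
  rfl

/-- The endomorphism `x ↦ u x • m` of `M`, depending linearly on `u` over the opposite endomorphism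
ring. -/
noncomputable def theta (m : M) : HomDual A M →ₗ[(Module.End A M)ᵐᵒᵖ] (Module.End A M)ᵐᵒᵖ where
  toFun u := MulOpposite.op (LinearMap.toSpanSingleton A M m ∘ₗ (show M →ₗ[A] A from u))
  map_add' u v := MulOpposite.unop_injective <| LinearMap.ext fun x => add_smul (u x) (v x) m
  map_smul' _ _ := rfl

@[simp]
lemma theta_unop_apply (m : M) (u : HomDual A M) (x : M) : (theta m u).unop x = u x • m := rfl

lemma theta_mul (m : M) (u : HomDual A M) (b : (Module.End A M)ᵐᵒᵖ) :
    theta m u * b = theta (b.unop m) u :=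
  MulOpposite.unop_injective <| LinearMap.ext fun x => map_smul b.unop (u x) m

lemma theta_add (m m' : M) (u : HomDual A M) : theta (m + m') u = theta m u + theta m' u :=
  MulOpposite.unop_injective <| LinearMap.ext fun x => smul_add (u x) m m'

variable {X : Type} [AddCommGroup X] [Module (Module.End A M)ᵐᵒᵖ X]

/-- The map `u ↦ theta m u • x`. -/
noncomputable def elem (A : Type) {M X : Type} [Ring A] [AddCommGroup M] [Module A M]
    [AddCommGroup X] [Module (Module.End A M)ᵐᵒᵖ X] (x : X) (m : M) :
    HomDual A M →ₗ[(Module.End A M)ᵐᵒᵖ] X :=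
  LinearMap.toSpanSingleton _ X x ∘ₗ theta m

lemma elem_apply (x : X) (m : M) (u : HomDual A M) : elem A x m u = theta m u • x := rfl

lemma elem_smul (b : (Module.End A M)ᵐᵒᵖ) (x : X) (m : M) :
    elem A (b • x) m = elem A x (b.unop m) :=
  LinearMap.ext fun u => by rw [elem_apply, elem_apply, ← mul_smul, theta_mul]

lemma elem_add_left (x y : X) (m : M) : elem A (x + y) m = elem A x m + elem A y m :=
  LinearMap.ext fun u => smul_add (theta m u) x y

lemma elem_add_right (x : X) (m m' : M) : elem A x (m + m') = elem A x m + elem A x m' :=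
  LinearMap.ext fun u => by
    rw [LinearMap.add_apply, elem_apply, elem_apply, elem_apply, theta_add, add_smul]

variable {n : ℕ} {u₀ : Fin n → HomDual A M} {m₀ : Fin n → M}

lemma sum_theta_smul (h : ∑ i, u₀ i (m₀ i) = 1) (u : HomDual A M) :
    ∑ i, theta (m₀ i) u • u₀ i = u := by
  ext m
  rw [sum_apply]
  simp only [smul_apply, theta_unop_apply, map_smul, smul_eq_mul]
  rw [← Finset.mul_sum, h, mul_one]

lemma sum_elem (h : ∑ i, u₀ i (m₀ i) = 1) (g : HomDual A M →ₗ[(Module.End A M)ᵐᵒᵖ] X) :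
    ∑ i, elem A (g (u₀ i)) (m₀ i) = g := by
  refine LinearMap.ext fun u => ?_
  conv_rhs => rw [← sum_theta_smul h u, map_sum]
  simp [elem_apply]

lemma finite (h : ∑ i, u₀ i (m₀ i) = 1) : Module.Finite (Module.End A M)ᵐᵒᵖ (HomDual A M) :=
  Module.Finite.of_surjective (Fintype.linearCombination (Module.End A M)ᵐᵒᵖ u₀) fun u =>
    ⟨fun i => theta (m₀ i) u, sum_theta_smul h u⟩

lemma projective (h : ∑ i, u₀ i (m₀ i) = 1) :
    Module.Projective (Module.End A M)ᵐᵒᵖ (HomDual A M) :=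
  Module.Projective.of_split (LinearMap.pi fun i => theta (m₀ i))
    (Fintype.linearCombination (Module.End A M)ᵐᵒᵖ u₀) (LinearMap.ext fun u => sum_theta_smul h u)

lemma apply_eq_mul (h : ∑ i, u₀ i (m₀ i) = 1)
    (e : HomDual A M →ₗ[(Module.End A M)ᵐᵒᵖ] HomDual A M) (u : HomDual A M) (m : M) :
    e u m = u m * ∑ i, e (u₀ i) (m₀ i) := by
  conv_lhs => rw [← sum_elem h e, LinearMap.sum_apply, sum_apply]
  simp [elem_apply, Finset.mul_sum]

lemma theta_smul {R : Type*} [Ring R] [Module R M] [SMulCommClass A R M] (c : R) (m : M)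
    (u : HomDual A M) : theta (c • m) u = c • theta m u :=
  MulOpposite.unop_injective <| LinearMap.ext fun x => smul_comm (u x) c m

lemma eq_zero_of_theta_mul_eq_zero (h : ∑ i, u₀ i (m₀ i) = 1) {r : ℕ} {g : Fin r → M}
    (hg : Submodule.span A (Set.range g) = ⊤) (b : (Module.End A M)ᵐᵒᵖ)
    (hb : ∀ i u, theta (g i) u * b = 0) : b = 0 := by
  refine MulOpposite.unop_injective <| LinearMap.ext_on_range hg fun i => ?_
  have hi : ∀ (u : HomDual A M) (m : M), u m • b.unop (g i) = 0 := fun u m => by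
    rw [← theta_unop_apply, ← theta_mul, hb]
    rfl
  rw [← one_smul A (b.unop (g i)), ← h, Finset.sum_smul]
  exact Finset.sum_eq_zero fun j _ => hi _ _

end Basic

section Algebra

variable {k A M : Type} [Field k] [Ring A] [Algebra k A] [AddCommGroup M] [Module A M]

noncomputable instance : Module k (HomDual A M) := inferInstanceAs (Module k (M →ₗ[A] A))

lemma eq_of_form_eq {lam : A →ₗ[k] k} (hnd : ∀ a, (∀ b, lam (b * a) = 0) → a = 0)
    {u v : HomDual A M} (h : ∀ m, lam (u m) = lam (v m)) : u = v := by
  ext m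
  refine sub_eq_zero.1 (hnd _ fun b => ?_)
  rw [mul_sub, map_sub, ← smul_eq_mul, ← smul_eq_mul, ← map_smul, ← map_smul, h, sub_self]

/-- For a nondegenerate functional `lam`, every functional on `A` has the form `lam (· * a)`. -/
noncomputable def formEquiv [FiniteDimensional k A] (lam : A →ₗ[k] k)
    (hnd : ∀ a, (∀ b, lam (b * a) = 0) → a = 0) :
    A ≃ₗ[k] Module.Dual k A :=
  LinearEquiv.ofInjectiveOfFinrankEq
    { toFun := fun a => lam ∘ₗ LinearMap.mulRight k a
      map_add' := fun a b => LinearMap.ext fun x => by simp [mul_add]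
      map_smul' := fun c a => LinearMap.ext fun x => by simp }
    ((injective_iff_map_eq_zero _).2 fun a ha => hnd a fun b => LinearMap.congr_fun ha b)
    Subspace.dual_finrank_eq.symm

lemma formEquiv_symm_spec [FiniteDimensional k A] {lam : A →ₗ[k] k}
    (hnd : ∀ a, (∀ b, lam (b * a) = 0) → a = 0) (ψ : Module.Dual k A)
    (a : A) : lam (a * (formEquiv lam hnd).symm ψ) = ψ a :=
  LinearMap.congr_fun ((formEquiv lam hnd).apply_symm_apply ψ) a

variable [Module k M] [IsScalarTower k A M]

lemma exists_form_eq [FiniteDimensional k A] {lam : A →ₗ[k] k}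
    (hnd : ∀ a, (∀ b, lam (b * a) = 0) → a = 0) (ψ : M →ₗ[k] k) :
    ∃ u : HomDual A M, ∀ m, lam (u m) = ψ m := by
  let β : M → Module.Dual k A := fun m => ψ ∘ₗ (LinearMap.toSpanSingleton A M m).restrictScalars k
  let u : M →ₗ[A] A :=
    { toFun := fun m => (formEquiv lam hnd).symm (β m)
      map_add' := fun m m' => by
        rw [← map_add]
        congr 1
        ext a
        simp [β]
      map_smul' := fun a m => by
        refine sub_eq_zero.1 (hnd _ fun b => ?_)
        rw [mul_sub, map_sub, RingHom.id_apply, smul_eq_mul, ← mul_assoc,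
          formEquiv_symm_spec, formEquiv_symm_spec]
        simp [β, mul_smul] }
  refine ⟨u, fun m => ?_⟩
  have hm := formEquiv_symm_spec hnd (β m) 1
  rw [one_mul] at hm
  exact hm.trans (by simp [β])

lemma exists_injective [FiniteDimensional k A] [FiniteDimensional k M] {lam : A →ₗ[k] k}
    (hnd : ∀ a, (∀ b, lam (b * a) = 0) → a = 0) :
    ∃ (d : ℕ) (i : (Module.End A M)ᵐᵒᵖ →ₗ[(Module.End A M)ᵐᵒᵖ] (Fin d → HomDual A M)),
      Function.Injective i := by
  let e := Module.finBasis k M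
  choose u hu using fun i => exists_form_eq (M := M) hnd (e.coord i)
  refine ⟨_, LinearMap.pi fun i => LinearMap.toSpanSingleton _ _ (u i),
    (injective_iff_map_eq_zero _).2 fun b hb => ?_⟩
  refine MulOpposite.unop_injective <| LinearMap.ext fun m => e.ext_elem fun i => ?_
  have h0 : (b • u i) m = 0 := by
    rw [show b • u i = 0 from congrFun hb i, zero_apply]
  change e.coord i (b.unop m) = e.coord i 0
  rw [← hu, ← smul_apply, h0, map_zero, map_zero]

variable [SMulCommClass A k M]

instance : IsScalarTower k (Module.End A M)ᵐᵒᵖ (HomDual A M) :=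
  ⟨fun c b u => ext fun m => LinearMap.map_smul_of_tower (show M →ₗ[A] A from u) c (b.unop m)⟩

/-- The trace on the endomorphisms of the `A`-dual of `M` induced by a functional on `A`. -/
noncomputable def trace (lam : A →ₗ[k] k) {n : ℕ} (u₀ : Fin n → HomDual A M) (m₀ : Fin n → M) :
    (HomDual A M →ₗ[(Module.End A M)ᵐᵒᵖ] HomDual A M) →ₗ[k] k where
  toFun e := lam (∑ i, e (u₀ i) (m₀ i))
  map_add' a b := by
    rw [← map_add, ← Finset.sum_add_distrib]
    rfl
  map_smul' c a := by
    rw [RingHom.id_apply, ← map_smul, Finset.smul_sum]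
    rfl

lemma trace_apply (lam : A →ₗ[k] k) {n : ℕ} (u₀ : Fin n → HomDual A M) (m₀ : Fin n → M)
    (e : HomDual A M →ₗ[(Module.End A M)ᵐᵒᵖ] HomDual A M) :
    trace lam u₀ m₀ e = lam (∑ i, e (u₀ i) (m₀ i)) :=
  rfl

variable {X : Type} [AddCommGroup X] [Module (Module.End A M)ᵐᵒᵖ X] {lam : A →ₗ[k] k} {n : ℕ}
  {u₀ : Fin n → HomDual A M} {m₀ : Fin n → M}

lemma trace_comp_elem (h : ∑ i, u₀ i (m₀ i) = 1)
    (f : X →ₗ[(Module.End A M)ᵐᵒᵖ] HomDual A M) (x : X) (m : M) :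
    trace lam u₀ m₀ (f ∘ₗ elem A x m) = lam (f x m) := by
  rw [trace_apply]
  simp only [LinearMap.comp_apply, elem_apply, map_smul, smul_apply, theta_unop_apply]
  simp only [smul_eq_mul]
  rw [← Finset.sum_mul, h, one_mul]

/-- The trace duality on the `A`-dual of a generator `M` over a symmetric algebra `A`. -/
noncomputable def traceDuality [FiniteDimensional k A] (hnd : ∀ a, (∀ b, lam (b * a) = 0) → a = 0)
    (hcomm : ∀ a b, lam (a * b) = lam (b * a)) (h : ∑ i, u₀ i (m₀ i) = 1) :
    TraceDuality k (Module.End A M)ᵐᵒᵖ (HomDual A M) where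
  tr := trace lam u₀ m₀
  tr_comm a b := by
    have key : ∀ a b : HomDual A M →ₗ[(Module.End A M)ᵐᵒᵖ] HomDual A M, trace lam u₀ m₀ (a ∘ₗ b) =
        lam ((∑ i, b (u₀ i) (m₀ i)) * ∑ i, a (u₀ i) (m₀ i)) := fun a b => by
      rw [trace_apply, Finset.sum_mul]
      simp only [LinearMap.comp_apply]
      exact congrArg lam (Finset.sum_congr rfl fun i _ => apply_eq_mul h a _ _)
    rw [key, key, hcomm]
  exists_rep X _ _ _ _ Φ := by
    choose f hf using fun x : X => exists_form_eq (M := M) hnd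
      { toFun := fun m => Φ (elem A x m)
        map_add' := fun m m' => by rw [elem_add_right, map_add]
        map_smul' := fun c m => by
          rw [RingHom.id_apply, ← map_smul]
          congr 1
          exact LinearMap.ext fun u => by
            rw [elem_apply, theta_smul, LinearMap.smul_apply, elem_apply, smul_assoc] }
    have hf' : ∀ x m, lam (f x m) = Φ (elem A x m) := hf
    let F : X →ₗ[(Module.End A M)ᵐᵒᵖ] HomDual A M :=
      { toFun := f
        map_add' := fun x y => eq_of_form_eq hnd fun m => by
          rw [add_apply, map_add, hf', hf', hf', elem_add_left, map_add]
        map_smul' := fun b x => eq_of_form_eq hnd fun m => by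
          rw [RingHom.id_apply, smul_apply, hf', hf', elem_smul] }
    refine ⟨F, fun g => ?_⟩
    conv_rhs => rw [← sum_elem h g, map_sum]
    rw [trace_apply, map_sum]
    exact Finset.sum_congr rfl fun i _ => hf' _ _
  eq_zero X _ _ f hf := LinearMap.ext fun x => eq_of_form_eq hnd fun m => by
    rw [← trace_comp_elem h f x m, hf]
    exact (map_zero lam).symm

end Algebra

end HomDual

lemma MemAddPlain.exists_sum_eq_one {A M : Type} [Ring A] [AddCommGroup M] [Module A M]
    (h : MemAddPlain A M A) :
    ∃ (n : ℕ) (u : Fin n → HomDual A M) (m : Fin n → M), ∑ i, u i (m i) = 1 := by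
  obtain ⟨n, Y, ⟨e⟩⟩ := h
  let q : (Fin n → M) →ₗ[A] A := LinearMap.fst A A Y ∘ₗ e.symm.toLinearMap
  refine ⟨n, fun i => q ∘ₗ LinearMap.single A (fun _ => M) i, e (1, 0), ?_⟩
  calc ∑ i, q (Pi.single i (e (1, 0) i)) = q (e (1, 0)) := by
        rw [← map_sum, Finset.univ_sum_single]
    _ = 1 := by simp [q]

/-- **Corollary 1.4 (second part)**. Let `A` be a finite-dimensional symmetric algebra over a
field `k`, `M` a finitely generated generator and `B = End_A(M)` (composition written on the
right, i.e. `(Module.End A M)ᵐᵒᵖ`). If `B` is virtually Gorenstein and has infinite dominant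
dimension, then `B` is a symmetric algebra. -/
theorem gendo_symmetric_virtually_gorenstein_infinite_dominant_dimension_is_symmetric
    (k A : Type) [Field k] [Ring A] [Algebra k A] [FiniteDimensional k A]
    (hsymm : IsSymmetricAlg k A)
    (M : Type) [AddCommGroup M] [Module A M] [Module k M] [IsScalarTower k A M]
    [SMulCommClass A k M] [Module.Finite A M]
    (hgen : MemAddPlain A M A)
    (hvg : VirtGorenstein (Module.End A M)ᵐᵒᵖ)
    (hdom : InfiniteDomDim (Module.End A M)ᵐᵒᵖ) :
    IsSymmetricAlg k (Module.End A M)ᵐᵒᵖ := by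
  obtain ⟨φ, hφ, hφ', hφ''⟩ := hsymm
  obtain ⟨n, u₀, m₀, h⟩ := hgen.exists_sum_eq_one
  have hlam : ∀ a b, φ 1 (a * b) = φ a b := fun a b => by rw [← hφ', one_mul]
  have hcomm : ∀ a b, φ 1 (a * b) = φ 1 (b * a) := fun a b => by rw [hlam, hlam, hφ]
  have hnd : ∀ a, (∀ b, φ 1 (b * a) = 0) → a = 0 := fun a ha =>
    hφ'' a fun b => by rw [hφ, ← hlam, ha]
  have hM : FiniteDimensional k M := Module.Finite.trans A M
  have hE : FiniteDimensional k (Module.End A M) :=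
    Module.Finite.of_injective (LinearMap.restrictScalarsₗ k A M M k)
      (LinearMap.restrictScalars_injective k)
  let t := HomDual.traceDuality hnd hcomm h
  have := t.injective
  have := HomDual.finite h
  have := HomDual.projective h
  obtain ⟨r, g, hg⟩ := Module.Finite.exists_fin (R := A) (M := M)
  refine isSymmetricAlg_of_traceDuality t (HomDual.exists_injective hnd)
    (∑ i : Fin r, HomDual.theta (g i) ∘ₗ LinearMap.proj i) (fun b hb => ?_) hvg hdom
  refine HomDual.eq_zero_of_theta_mul_eq_zero h hg b fun i u => ?_
  rw [← hb (Pi.single i u), LinearMap.sum_apply, Finset.sum_eq_single_of_mem i (Finset.mem_univ i)]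
  · simp
  · intro l _ hl
    simp [Pi.single_eq_of_ne hl]
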